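/- Let n ≥ 3 be an integer, let n₀ = max{⌈(n²−n−2)/2⌉, n}, and define α₀ = 2⌈n₀/2⌉ and α_i = (n−1)·R(n, α_{i−1}+1) − 1 for i ≥ 1, where R denotes the Ramsey number. Then every weakly connected digraph D satisfying (D1), (D2) and (D3) satisfies pc(D) ≤ Σ_{i=1}^{2n₀−1} α_i + n(2n−1)(n−1) + (n+1)·((n−2)n(n+5)/2 + 6(n−2)). -/

import Mathlib

/-! ## Basic notions for graphs and digraphs

A digraph on a vertex type `V` is given by its arc relation `E : V → V → Prop`.
Simplicity and absence of 2-cycles is expressed by the hypothesis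
`∀ u v, E u v → ¬ E v u`.  The underlying graph `G_D` is `SimpleGraph.fromRel E`. -/

/-- `G` contains an induced copy of the simple graph `H`. -/
def HasInducedCopyG {W V : Type} (H : SimpleGraph W) (G : SimpleGraph V) : Prop :=
  ∃ f : W → V, Function.Injective f ∧ ∀ a b : W, G.Adj (f a) (f b) ↔ H.Adj a b

/-- The digraph `E` contains an induced copy of the digraph `H`. -/
def DigraphHasInducedCopy {W V : Type} (H : W → W → Prop) (E : V → V → Prop) : Prop :=
  ∃ f : W → V, Function.Injective f ∧ ∀ a b : W, E (f a) (f b) ↔ H a b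

/-- The star `K_{1,n}` with one center and `n` leaves. -/
def StarG (n : ℕ) : SimpleGraph (Unit ⊕ Fin n) :=
  SimpleGraph.fromRel (fun a b =>
    match a, b with
    | Sum.inl _, Sum.inr _ => True
    | _, _ => False)

/-- The path `P_n` of order `n`. -/
def PathG (n : ℕ) : SimpleGraph (Fin n) :=
  SimpleGraph.fromRel (fun i j => i.val + 1 = j.val)

/-- The graph `K*_n`: a complete graph on the `x_i` together with pendant edges `x_i y_i`. -/
def KStarG (n : ℕ) : SimpleGraph (Fin n ⊕ Fin n) :=
  SimpleGraph.fromRel (fun a b =>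
    match a, b with
    | Sum.inl i, Sum.inl j => i ≠ j
    | Sum.inl i, Sum.inr j => i = j
    | _, _ => False)

/-- The graph `F^(1)_n` on `{x₁,x₂} ∪ {yᵢ} ∪ {zᵢ}`:
edges `x₁x₂, x₁y₁, x₁z₁` together with the two paths `y₁⋯y_n` and `z₁⋯z_n`. -/
def F1G (n : ℕ) : SimpleGraph (Fin 2 ⊕ Fin n ⊕ Fin n) :=
  SimpleGraph.fromRel (fun a b =>
    match a, b with
    | Sum.inl i, Sum.inl j => i.val = 0 ∧ j.val = 1
    | Sum.inl i, Sum.inr (Sum.inl j) => i.val = 0 ∧ j.val = 0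
    | Sum.inl i, Sum.inr (Sum.inr j) => i.val = 0 ∧ j.val = 0
    | Sum.inr (Sum.inl i), Sum.inr (Sum.inl j) => i.val + 1 = j.val
    | Sum.inr (Sum.inr i), Sum.inr (Sum.inr j) => i.val + 1 = j.val
    | _, _ => False)

/-- The single edge `y₁z₁` (used to build `F^(2)_n` and `F^(4)_n`). -/
def YZEdgeG (n : ℕ) : SimpleGraph (Fin 2 ⊕ Fin n ⊕ Fin n) :=
  SimpleGraph.fromRel (fun a b =>
    match a, b with
    | Sum.inr (Sum.inl i), Sum.inr (Sum.inr j) => i.val = 0 ∧ j.val = 0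
    | _, _ => False)

/-- `F^(2)_n = F^(1)_n + y₁z₁`. -/
def F2G (n : ℕ) : SimpleGraph (Fin 2 ⊕ Fin n ⊕ Fin n) := F1G n ⊔ YZEdgeG n

/-- The graph `F^(3)_n`: edges `x₁y₁, x₁z₁, x₂y₁, x₂z₁` together with the two paths. -/
def F3G (n : ℕ) : SimpleGraph (Fin 2 ⊕ Fin n ⊕ Fin n) :=
  SimpleGraph.fromRel (fun a b =>
    match a, b with
    | Sum.inl _, Sum.inr (Sum.inl j) => j.val = 0
    | Sum.inl _, Sum.inr (Sum.inr j) => j.val = 0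
    | Sum.inr (Sum.inl i), Sum.inr (Sum.inl j) => i.val + 1 = j.val
    | Sum.inr (Sum.inr i), Sum.inr (Sum.inr j) => i.val + 1 = j.val
    | _, _ => False)

/-- `F^(4)_n = F^(3)_n + y₁z₁`. -/
def F4G (n : ℕ) : SimpleGraph (Fin 2 ⊕ Fin n ⊕ Fin n) := F3G n ⊔ YZEdgeG n

/-- The digraph `D^(1)_n` on `{x₁} ∪ {yᵢ} ∪ {zᵢ}` with arcs
`(x₁,y₁), (z₁,x₁), (y₁,z₁)`, `(y_{i+1}, y_i)` and `(z_i, z_{i+1})`. -/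
def D1Rel (n : ℕ) : (Unit ⊕ Fin n ⊕ Fin n) → (Unit ⊕ Fin n ⊕ Fin n) → Prop := fun a b =>
  match a, b with
  | Sum.inl _, Sum.inr (Sum.inl j) => j.val = 0
  | Sum.inr (Sum.inr i), Sum.inl _ => i.val = 0
  | Sum.inr (Sum.inl i), Sum.inr (Sum.inr j) => i.val = 0 ∧ j.val = 0
  | Sum.inr (Sum.inl i), Sum.inr (Sum.inl j) => j.val + 1 = i.val
  | Sum.inr (Sum.inr i), Sum.inr (Sum.inr j) => i.val + 1 = j.val
  | _, _ => False

/-- `D^(2)_n`: obtained from `D^(1)_n` by replacing the arc `(z₁,x₁)` by `(x₁,z₁)`. -/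
def D2Rel (n : ℕ) : (Unit ⊕ Fin n ⊕ Fin n) → (Unit ⊕ Fin n ⊕ Fin n) → Prop := fun a b =>
  match a, b with
  | Sum.inl _, Sum.inr (Sum.inl j) => j.val = 0
  | Sum.inl _, Sum.inr (Sum.inr j) => j.val = 0
  | Sum.inr (Sum.inl i), Sum.inr (Sum.inr j) => i.val = 0 ∧ j.val = 0
  | Sum.inr (Sum.inl i), Sum.inr (Sum.inl j) => j.val + 1 = i.val
  | Sum.inr (Sum.inr i), Sum.inr (Sum.inr j) => i.val + 1 = j.val
  | _, _ => False

/-- `D^(3)_n`: obtained from `D^(1)_n` by replacing the arc `(x₁,y₁)` by `(y₁,x₁)`. -/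
def D3Rel (n : ℕ) : (Unit ⊕ Fin n ⊕ Fin n) → (Unit ⊕ Fin n ⊕ Fin n) → Prop := fun a b =>
  match a, b with
  | Sum.inr (Sum.inl i), Sum.inl _ => i.val = 0
  | Sum.inr (Sum.inr i), Sum.inl _ => i.val = 0
  | Sum.inr (Sum.inl i), Sum.inr (Sum.inr j) => i.val = 0 ∧ j.val = 0
  | Sum.inr (Sum.inl i), Sum.inr (Sum.inl j) => j.val + 1 = i.val
  | Sum.inr (Sum.inr i), Sum.inr (Sum.inr j) => i.val + 1 = j.val
  | _, _ => False

/-- The transitive tournament `T_n`. -/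
def TRel (n : ℕ) : Fin n → Fin n → Prop := fun i j => i < j

/-- A (nonempty) directed path in the digraph `E`, recorded as its list of vertices. -/
def IsDirPathList {V : Type} (E : V → V → Prop) (l : List V) : Prop :=
  l ≠ [] ∧ l.Nodup ∧ l.Chain' E

/-- The path cover number of the subdigraph of `E` induced by `X`:
the minimum number of directed paths of `E[X]` whose vertex sets cover `X`. -/
noncomputable def pcOn {V : Type} (E : V → V → Prop) (X : Set V) : ℕ :=
  sInf {k | ∃ P : Finset (List V), P.card = k ∧
    (∀ l ∈ P, IsDirPathList E l ∧ ∀ v ∈ l, v ∈ X) ∧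
    ∀ v ∈ X, ∃ l ∈ P, v ∈ l}

/-- The path partition number of the subdigraph of `E` induced by `X`:
the minimum number of pairwise vertex-disjoint directed paths of `E[X]`
whose vertex sets partition `X`. -/
noncomputable def ppOn {V : Type} (E : V → V → Prop) (X : Set V) : ℕ :=
  sInf {k | ∃ P : Finset (List V), P.card = k ∧
    (∀ l ∈ P, IsDirPathList E l ∧ ∀ v ∈ l, v ∈ X) ∧
    (∀ v ∈ X, ∃ l ∈ P, v ∈ l) ∧
    ∀ l ∈ P, ∀ l' ∈ P, l ≠ l' → ∀ v ∈ l, v ∉ l'}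

/-- A (nonempty) path in the simple graph `G`, recorded as its list of vertices. -/
def IsPathList {V : Type} (G : SimpleGraph V) (l : List V) : Prop :=
  l ≠ [] ∧ l.Nodup ∧ l.Chain' G.Adj

/-- The path cover number `pc(G)` of a simple graph `G`. -/
noncomputable def pcG {V : Type} (G : SimpleGraph V) : ℕ :=
  sInf {k | ∃ P : Finset (List V), P.card = k ∧
    (∀ l ∈ P, IsPathList G l) ∧ ∀ v : V, ∃ l ∈ P, v ∈ l}

/-- The path partition number `pp(G)` of a simple graph `G`. -/
noncomputable def ppG {V : Type} (G : SimpleGraph V) : ℕ :=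
  sInf {k | ∃ P : Finset (List V), P.card = k ∧
    (∀ l ∈ P, IsPathList G l) ∧ (∀ v : V, ∃ l ∈ P, v ∈ l) ∧
    ∀ l ∈ P, ∀ l' ∈ P, l ≠ l' → ∀ v ∈ l, v ∉ l'}

/-- A directed cycle in the digraph `E`, recorded as its list of vertices. -/
def IsDirCycleList {V : Type} (E : V → V → Prop) (l : List V) : Prop :=
  ∃ h : l ≠ [], 3 ≤ l.length ∧ l.Nodup ∧ l.Chain' E ∧ E (l.getLast h) (l.head h)

/-- A member of a cycle cover/partition: a directed cycle, or a weakly connected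
subdigraph of order at most two. -/
def IsCyclePartMember {V : Type} (E : V → V → Prop) (l : List V) : Prop :=
  IsDirCycleList E l ∨
    (l ≠ [] ∧ l.length ≤ 2 ∧ l.Nodup ∧ l.Chain' (fun a b => E a b ∨ E b a))

/-- The cycle partition number `cp(D)` of the digraph `E`. -/
noncomputable def cpNum {V : Type} (E : V → V → Prop) : ℕ :=
  sInf {k | ∃ P : Finset (List V), P.card = k ∧
    (∀ l ∈ P, IsCyclePartMember E l) ∧
    (∀ v : V, ∃ l ∈ P, v ∈ l) ∧
    ∀ l ∈ P, ∀ l' ∈ P, l ≠ l' → ∀ v ∈ l, v ∉ l'}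

/-- `v : Fin m → V` enumerates an induced path of the simple graph `G`. -/
def IsInducedPathEmb {V : Type} (G : SimpleGraph V) {m : ℕ} (v : Fin m → V) : Prop :=
  Function.Injective v ∧
    ∀ i j : Fin m, G.Adj (v i) (v j) ↔ (i.val + 1 = j.val ∨ j.val + 1 = i.val)

/-- `w : Fin m → V` enumerates an induced pseudo-path of the digraph `E`:
the induced subdigraph on its image has a path as underlying graph. -/
def IsInducedPsPath {V : Type} (E : V → V → Prop) {m : ℕ} (w : Fin m → V) : Prop :=
  Function.Injective w ∧
    ∀ i j : Fin m, (E (w i) (w j) ∨ E (w j) (w i)) ↔ (i.val + 1 = j.val ∨ j.val + 1 = i.val)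

/-- `r(P)` for a pseudo-path enumerated by `w`: the number of (internal) vertices
having out-degree 2 or in-degree 2 in the pseudo-path. -/
noncomputable def turnCount {V : Type} (E : V → V → Prop) {m : ℕ} (w : Fin m → V) : ℕ :=
  Set.ncard {i : Fin m | ∃ j k : Fin m, j.val + 1 = i.val ∧ i.val + 1 = k.val ∧
    ((E (w i) (w j) ∧ E (w i) (w k)) ∨ (E (w j) (w i) ∧ E (w k) (w i)))}

/-- Condition (D1): the underlying graph of `E` is `{K*_n, K_{1,n}, F^(1)_n, F^(2)_n}`-free. -/
def CondD1 {V : Type} (n : ℕ) (E : V → V → Prop) : Prop :=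
  ¬ HasInducedCopyG (KStarG n) (SimpleGraph.fromRel E) ∧
  ¬ HasInducedCopyG (StarG n) (SimpleGraph.fromRel E) ∧
  ¬ HasInducedCopyG (F1G n) (SimpleGraph.fromRel E) ∧
  ¬ HasInducedCopyG (F2G n) (SimpleGraph.fromRel E)

/-- Condition (D'1): the underlying graph of `E` is
`{K*_n, K_{1,n}, F^(1)_n, F^(2)_n, F^(3)_n, F^(4)_n}`-free. -/
def CondD1' {V : Type} (n : ℕ) (E : V → V → Prop) : Prop :=
  CondD1 n E ∧
  ¬ HasInducedCopyG (F3G n) (SimpleGraph.fromRel E) ∧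
  ¬ HasInducedCopyG (F4G n) (SimpleGraph.fromRel E)

/-- Condition (D2): `E` is `{D^(1)_n, D^(2)_n, D^(3)_n}`-free. -/
def CondD2 {V : Type} (n : ℕ) (E : V → V → Prop) : Prop :=
  ¬ DigraphHasInducedCopy (D1Rel n) E ∧
  ¬ DigraphHasInducedCopy (D2Rel n) E ∧
  ¬ DigraphHasInducedCopy (D3Rel n) E

/-- Condition (D3): `r(P) ≤ n` for every induced pseudo-path `P` of `E`. -/
def CondD3 {V : Type} (n : ℕ) (E : V → V → Prop) : Prop :=
  ∀ (m : ℕ) (w : Fin m → V), IsInducedPsPath E w → turnCount E w ≤ n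

/-- The Ramsey number `R(a, b)`: the least `R` such that every graph on at least `R`
vertices contains a clique of size `a` or an independent set of size `b`. -/
noncomputable def ramseyNumber (a b : ℕ) : ℕ :=
  sInf {R | ∀ m : ℕ, R ≤ m → ∀ G : SimpleGraph (Fin m),
    (∃ s : Finset (Fin m), G.IsNClique a s) ∨ (∃ s : Finset (Fin m), Gᶜ.IsNClique b s)}

/-- The independence number of the subgraph of `G` induced by `X`. -/
noncomputable def indepNumOn {V : Type} (G : SimpleGraph V) (X : Set V) : ℕ :=
  sSup {k | ∃ s : Finset V, ↑s ⊆ X ∧ s.card = k ∧ ∀ a ∈ s, ∀ b ∈ s, a ≠ b → ¬ G.Adj a b}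

/-- The independence number `α(G)`. -/
noncomputable def indepNum {V : Type} (G : SimpleGraph V) : ℕ := indepNumOn G Set.univ

/-- The neighborhood `N_G(X)` of a set of vertices. -/
def nbhd {V : Type} (G : SimpleGraph V) (X : Set V) : Set V :=
  {v | v ∉ X ∧ ∃ x ∈ X, G.Adj v x}

section PathCovers

variable {V : Type}

/-- Every set of pairwise non-adjacent vertices inside `X` has at most `k` elements. -/
def IndepBound (E : V → V → Prop) (X : Set V) (k : ℕ) : Prop :=
  ∀ S : Finset V, (∀ a ∈ S, a ∈ X) → (∀ a ∈ S, ∀ b ∈ S, ¬ E a b) → S.card ≤ k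

/-- `X` is covered by at most `k` (possibly empty) directed paths of `E`. -/
def PathCoverable (E : V → V → Prop) (X : Set V) (k : ℕ) : Prop :=
  ∃ F : List (List V), F.length ≤ k ∧ (∀ l ∈ F, l.Nodup ∧ l.IsChain E) ∧
    ∀ v ∈ X, ∃ l ∈ F, v ∈ l

/-- The vertices of a family of nonempty lists, each given by its head and its tail. -/
def familyVerts (F : List (V × List V)) : List V := F.flatMap fun p => p.1 :: p.2

theorem heads_sublist_familyVerts (F : List (V × List V)) :
    (F.map Prod.fst).Sublist (familyVerts F) := by
  induction F with
  | nil => simp [familyVerts]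
  | cons p F ih =>
    simp only [familyVerts, List.map_cons, List.flatMap_cons, List.cons_append]
    exact List.Sublist.cons_cons _ (ih.trans (List.sublist_append_right _ _))

theorem gallaiMilgram_aux (E : V → V → Prop) (hirr : ∀ v, ¬ E v v) (N : ℕ) :
    ∀ F : List (V × List V), (familyVerts F).length + F.length = N →
      (∀ p ∈ F, (p.1 :: p.2).IsChain fun a b => E b a) → (familyVerts F).Nodup →
      ∃ F' : List (V × List V), (∀ p ∈ F', (p.1 :: p.2).IsChain fun a b => E b a) ∧
        (familyVerts F').Nodup ∧ (∀ x, x ∈ familyVerts F' ↔ x ∈ familyVerts F) ∧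
        (∀ p ∈ F', ∃ q ∈ F, q.1 = p.1) ∧
        ∃ S : Finset V, (∀ x ∈ S, x ∈ familyVerts F) ∧ (∀ a ∈ S, ∀ b ∈ S, ¬ E a b) ∧
          F'.length ≤ S.card := by
  classical
  induction N using Nat.strong_induction_on with
  | _ N ih =>
  intro F hN hchain hnd
  by_cases hind : ∀ p ∈ F, ∀ q ∈ F, ¬ E q.1 p.1
  · refine ⟨F, hchain, hnd, fun _ => Iff.rfl, fun p hp => ⟨p, hp, rfl⟩,
      (F.map Prod.fst).toFinset, ?_, ?_, ?_⟩
    · intro x hx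
      simp only [List.mem_toFinset, List.mem_map] at hx
      obtain ⟨p, hp, rfl⟩ := hx
      exact List.mem_flatMap.2 ⟨p, hp, by simp⟩
    · intro a ha b hb
      simp only [List.mem_toFinset, List.mem_map] at ha hb
      obtain ⟨p, hp, rfl⟩ := ha
      obtain ⟨q, hq, rfl⟩ := hb
      exact hind q hq p hp
    · rw [List.toFinset_card_of_nodup ((heads_sublist_familyVerts F).nodup hnd)]
      simp
  · push Not at hind
    obtain ⟨p, hp, q, hq, hqp⟩ := hind
    have hne : q ≠ p := by rintro rfl; exact hirr _ hqp
    have hperm : F.Perm (p :: q :: (F.erase p).erase q) :=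
      (List.perm_cons_erase hp).trans
        (List.Perm.cons _ (List.perm_cons_erase ((List.mem_erase_of_ne hne).2 hq)))
    generalize (F.erase p).erase q = rest at hperm
    have hvp : (familyVerts F).Perm (familyVerts (p :: q :: rest)) :=
      List.Perm.flatMap_right _ hperm
    have hlen : (familyVerts F).length = (familyVerts (p :: q :: rest)).length := hvp.length_eq
    have hlen' := hperm.length_eq
    rw [hvp.nodup_iff] at hnd
    have hchain' : ∀ x ∈ p :: q :: rest, (x.1 :: x.2).IsChain fun a b => E b a :=
      fun x hx => hchain x (hperm.mem_iff.2 hx)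
    simp only [hvp.mem_iff, hperm.mem_iff]
    clear hchain hp hq hvp hperm
    obtain ⟨v, l⟩ := p
    obtain ⟨w, k⟩ := q
    have hcp := hchain' (v, l) (by simp)
    have hcq := hchain' (w, k) (by simp)
    have hcr : ∀ x ∈ rest, (x.1 :: x.2).IsChain fun a b => E b a :=
      fun x hx => hchain' x (by simp [hx])
    cases l with
    | nil =>
      obtain ⟨F', h1, h2, h3, h4, S, h5, h6, h7⟩ := ih
        ((familyVerts ((v, w :: k) :: rest)).length + ((v, w :: k) :: rest).length)
        (by simp [familyVerts] at *; omega) ((v, w :: k) :: rest) rfl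
        (by
          intro x hx
          rcases List.mem_cons.1 hx with rfl | hx
          · exact List.IsChain.cons_cons hqp hcq
          · exact hcr x hx)
        (by simpa [familyVerts] using hnd)
      refine ⟨F', h1, h2, ?_, ?_, S, ?_, h6, h7⟩
      · intro x; rw [h3]; simp [familyVerts]
      · intro x hx
        obtain ⟨y, hy, hyx⟩ := h4 x hx
        rcases List.mem_cons.1 hy with rfl | hy
        · exact ⟨(v, []), by simp, hyx⟩
        · exact ⟨y, by simp [hy], hyx⟩
      · intro x hx; have := h5 x hx; simpa [familyVerts] using this
    | cons t l =>
      have hEt : E t v := by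
        have := hcp; simp at this; exact this.1
      have hvnot : v ∉ familyVerts ((t, l) :: (w, k) :: rest) := by
        simp [familyVerts] at hnd ⊢; tauto
      obtain ⟨F', h1, h2, h3, h4, S, h5, h6, h7⟩ := ih
        ((familyVerts ((t, l) :: (w, k) :: rest)).length + ((t, l) :: (w, k) :: rest).length)
        (by simp [familyVerts] at *; omega) ((t, l) :: (w, k) :: rest) rfl
        (by
          intro x hx
          rcases List.mem_cons.1 hx with rfl | hx
          · exact List.isChain_of_isChain_cons hcp
          · exact hchain' x (by simp only [List.mem_cons] at hx ⊢; tauto))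
        (by
          have : familyVerts ((v, t :: l) :: (w, k) :: rest) =
              v :: familyVerts ((t, l) :: (w, k) :: rest) := by simp [familyVerts]
          rw [this] at hnd; exact (List.nodup_cons.1 hnd).2)
      have hverts : ∀ x, x ∈ familyVerts ((v, t :: l) :: (w, k) :: rest) ↔
          x = v ∨ x ∈ familyVerts ((t, l) :: (w, k) :: rest) := by
        intro x; simp [familyVerts]
      -- extend a path of the smaller family by the vertex `v`
      have hext : ∀ p ∈ F', E p.1 v →
          ∃ F'' : List (V × List V), (∀ p ∈ F'', (p.1 :: p.2).IsChain fun a b => E b a) ∧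
          (familyVerts F'').Nodup ∧
          (∀ x, x ∈ familyVerts F'' ↔ x = v ∨ x ∈ familyVerts ((t, l) :: (w, k) :: rest)) ∧
          (∀ y ∈ F'', y.1 = v ∨ (y ∈ F' ∧ y ≠ p)) ∧ F''.length = F'.length := by
        intro p hp hE
        have hperm := List.perm_cons_erase hp
        have hvp : (familyVerts F').Perm (familyVerts (p :: F'.erase p)) :=
          List.Perm.flatMap_right _ hperm
        have hnd' := hvp.nodup_iff.1 h2
        refine ⟨(v, p.1 :: p.2) :: F'.erase p, ?_, ?_, ?_, ?_, ?_⟩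
        · intro x hx
          rcases List.mem_cons.1 hx with rfl | hx
          · exact List.IsChain.cons_cons hE (h1 p hp)
          · exact h1 x (List.mem_of_mem_erase hx)
        · have : familyVerts ((v, p.1 :: p.2) :: F'.erase p) =
              v :: familyVerts (p :: F'.erase p) := by simp [familyVerts]
          rw [this, List.nodup_cons]
          refine ⟨?_, hnd'⟩
          rw [← hvp.mem_iff, h3]; exact hvnot
        · intro x
          rw [← h3, hvp.mem_iff]; simp [familyVerts]
        · intro y hy
          rcases List.mem_cons.1 hy with rfl | hy
          · exact Or.inl rfl
          · refine Or.inr ⟨List.mem_of_mem_erase hy, ?_⟩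
            rintro rfl
            have h8 : y.1 ∈ familyVerts (F'.erase y) := List.mem_flatMap.2 ⟨y, hy, by simp⟩
            simp only [familyVerts, List.flatMap_cons, List.cons_append, List.nodup_cons,
              List.mem_append] at hnd'
            exact hnd'.1 (Or.inr h8)
        · have := hperm.length_eq; simpa using this.symm
      have huniq : ∀ p ∈ F', ∀ p' ∈ F', p.1 = p'.1 → p = p' := by
        clear * - h2
        induction F' with
        | nil => simp
        | cons a F' ihF =>
          have h8 : ∀ p ∈ F', p.1 ≠ a.1 := by
            intro p hp he
            simp only [familyVerts, List.flatMap_cons, List.cons_append, List.nodup_cons,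
              List.mem_append] at h2
            exact h2.1 (Or.inr (List.mem_flatMap.2 ⟨p, hp, by simp [he]⟩))
          have h9 := ihF (by
            simp only [familyVerts, List.flatMap_cons] at h2
            exact (List.nodup_append.1 h2).2.1)
          intro p hp p' hp' he
          rcases List.mem_cons.1 hp with h | h <;> rcases List.mem_cons.1 hp' with h' | h'
          · rw [h, h']
          · exact absurd (by rw [← he, h]) (h8 _ h')
          · exact absurd (by rw [he, h']) (h8 _ h)
          · exact h9 p h p' h' he
      by_cases ht : ∃ p ∈ F', p.1 = t
      · obtain ⟨p, hp, hpt⟩ := ht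
        obtain ⟨F'', g1, g2, g3, g4, g5⟩ := hext p hp (by rw [hpt]; exact hEt)
        refine ⟨F'', g1, g2, fun x => by rw [g3, hverts], ?_, S,
          fun x hx => (hverts x).2 (Or.inr (h5 x hx)), h6, by omega⟩
        intro y hy
        rcases g4 y hy with hyv | ⟨hy1, hy2⟩
        · exact ⟨(v, t :: l), by simp, hyv.symm⟩
        · obtain ⟨z, hz, hzy⟩ := h4 y hy1
          rcases List.mem_cons.1 hz with rfl | hz
          · exact absurd (huniq y hy1 p hp (by rw [hpt, ← hzy])) hy2
          · exact ⟨z, by simp only [List.mem_cons] at hz ⊢; tauto, hzy⟩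
      by_cases hw : ∃ p ∈ F', p.1 = w
      · obtain ⟨p, hp, hpw⟩ := hw
        obtain ⟨F'', g1, g2, g3, g4, g5⟩ := hext p hp (by rw [hpw]; exact hqp)
        refine ⟨F'', g1, g2, fun x => by rw [g3, hverts], ?_, S,
          fun x hx => (hverts x).2 (Or.inr (h5 x hx)), h6, by omega⟩
        intro y hy
        rcases g4 y hy with hyv | ⟨hy1, hy2⟩
        · exact ⟨(v, t :: l), by simp, hyv.symm⟩
        · obtain ⟨z, hz, hzy⟩ := h4 y hy1
          rcases List.mem_cons.1 hz with rfl | hz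
          · exact absurd ⟨y, hy1, hzy.symm⟩ ht
          · exact ⟨z, by simp only [List.mem_cons] at hz ⊢; tauto, hzy⟩
      have hF'len : F'.length ≤ rest.length := by
        have hmap : ∀ x ∈ F'.map Prod.fst, x ∈ rest.map Prod.fst := by
          intro x hx
          obtain ⟨y, hy, rfl⟩ := List.mem_map.1 hx
          obtain ⟨z, hz, hzy⟩ := h4 y hy
          simp only [List.mem_cons] at hz
          rcases hz with rfl | rfl | hz
          · exact absurd ⟨y, hy, hzy.symm⟩ ht
          · exact absurd ⟨y, hy, hzy.symm⟩ hw
          · exact List.mem_map.2 ⟨z, hz, hzy⟩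
        have := (List.subperm_of_subset ((heads_sublist_familyVerts F').nodup h2) hmap).length_le
        simpa using this
      have hv' : (familyVerts ((v, []) :: F')).length =
          (familyVerts ((v, t :: l) :: (w, k) :: rest)).length := by
        apply List.Perm.length_eq
        rw [List.perm_ext_iff_of_nodup _ hnd]
        · intro x; rw [hverts, ← h3]; simp [familyVerts]
        · have : familyVerts ((v, ([] : List V)) :: F') = v :: familyVerts F' := by
            simp [familyVerts]
          rw [this, List.nodup_cons, h3]; exact ⟨hvnot, h2⟩
      obtain ⟨F'', g1, g2, g3, g4, S', g5, g6, g7⟩ := ih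
        ((familyVerts ((v, []) :: F')).length + ((v, []) :: F').length)
        (by simp only [List.length_cons] at *; omega) ((v, []) :: F') rfl
        (by
          intro x hx
          rcases List.mem_cons.1 hx with rfl | hx
          · simp
          · exact h1 x hx)
        (by
          have : familyVerts ((v, ([] : List V)) :: F') = v :: familyVerts F' := by
            simp [familyVerts]
          rw [this, List.nodup_cons, h3]; exact ⟨hvnot, h2⟩)
      have hv'' : ∀ x, x ∈ familyVerts ((v, []) :: F') ↔
          x ∈ familyVerts ((v, t :: l) :: (w, k) :: rest) := by
        intro x; rw [hverts, ← h3]; simp [familyVerts]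
      refine ⟨F'', g1, g2, fun x => by rw [g3, hv''], ?_, S', fun x hx => (hv'' x).1 (g5 x hx),
        g6, g7⟩
      intro y hy
      obtain ⟨z, hz, hzy⟩ := g4 y hy
      rcases List.mem_cons.1 hz with rfl | hz
      · exact ⟨(v, t :: l), by simp, hzy⟩
      · obtain ⟨z', hz', hz''⟩ := h4 z hz
        rcases List.mem_cons.1 hz' with rfl | hz'
        · exact absurd ⟨z, hz, hz''.symm⟩ ht
        · exact ⟨z', by simp only [List.mem_cons] at hz' ⊢; tauto, by rw [hz'', hzy]⟩

/-- The Gallai–Milgram theorem for induced subdigraphs. -/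
theorem exists_paths_of_indepBound [Finite V] {E : V → V → Prop} (hirr : ∀ v, ¬ E v v)
    {X : Set V} {k : ℕ} (h : IndepBound E X k) :
    ∃ F : List (List V), F.length ≤ k ∧ (∀ l ∈ F, l.Nodup ∧ l.IsChain E ∧ ∀ v ∈ l, v ∈ X) ∧
      ∀ v ∈ X, ∃ l ∈ F, v ∈ l := by
  classical
  have hX : X.Finite := Set.toFinite X
  let F₀ : List (V × List V) := hX.toFinset.toList.map fun v => (v, [])
  have hF₀ : familyVerts F₀ = hX.toFinset.toList := by
    simp [F₀, familyVerts, List.flatMap_map]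
  have hmem : ∀ x, x ∈ familyVerts F₀ ↔ x ∈ X := by simp [hF₀]
  obtain ⟨F, h1, h2, h3, -, S, h5, h6, h7⟩ := gallaiMilgram_aux E hirr _ F₀ rfl
    (by intro p hp; simp only [F₀, List.mem_map] at hp; obtain ⟨v, -, rfl⟩ := hp; simp)
    (by rw [hF₀]; exact Finset.nodup_toList _)
  refine ⟨F.map fun p => (p.1 :: p.2).reverse, ?_, ?_, ?_⟩
  · rw [List.length_map]
    exact h7.trans (h S (fun a ha => (hmem a).1 (h5 a ha)) h6)
  · intro l hl
    obtain ⟨p, hp, rfl⟩ := List.mem_map.1 hl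
    refine ⟨?_, ?_, ?_⟩
    · rw [List.nodup_reverse]
      exact (List.nodup_flatMap.1 h2).1 p hp
    · rw [List.isChain_reverse]; exact h1 p hp
    · intro v hv
      rw [List.mem_reverse] at hv
      exact (hmem v).1 ((h3 v).1 (List.mem_flatMap.2 ⟨p, hp, hv⟩))
  · intro v hv
    obtain ⟨p, hp, hvp⟩ := List.mem_flatMap.1 ((h3 v).2 ((hmem v).2 hv))
    exact ⟨_, List.mem_map.2 ⟨p, hp, rfl⟩, List.mem_reverse.2 hvp⟩

theorem IndepBound.pathCoverable [Finite V] {E : V → V → Prop} (hirr : ∀ v, ¬ E v v)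
    {X : Set V} {k : ℕ} (h : IndepBound E X k) : PathCoverable E X k := by
  obtain ⟨F, h1, h2, h3⟩ := exists_paths_of_indepBound hirr h
  exact ⟨F, h1, fun l hl => ⟨(h2 l hl).1, (h2 l hl).2.1⟩, h3⟩

theorem PathCoverable.union {E : V → V → Prop} {X Y : Set V} {j k : ℕ}
    (hX : PathCoverable E X j) (hY : PathCoverable E Y k) : PathCoverable E (X ∪ Y) (j + k) := by
  obtain ⟨F, h1, h2, h3⟩ := hX
  obtain ⟨F', g1, g2, g3⟩ := hY
  refine ⟨F ++ F', by rw [List.length_append]; omega, ?_, ?_⟩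
  · intro l hl
    rcases List.mem_append.1 hl with hl | hl
    · exact h2 l hl
    · exact g2 l hl
  · rintro v (hv | hv)
    · obtain ⟨l, hl, hvl⟩ := h3 v hv
      exact ⟨l, List.mem_append_left _ hl, hvl⟩
    · obtain ⟨l, hl, hvl⟩ := g3 v hv
      exact ⟨l, List.mem_append_right _ hl, hvl⟩

theorem PathCoverable.mono {E : V → V → Prop} {X Y : Set V} {j k : ℕ}
    (hX : PathCoverable E X j) (hYX : Y ⊆ X) (hjk : j ≤ k) : PathCoverable E Y k := by
  obtain ⟨F, h1, h2, h3⟩ := hX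
  exact ⟨F, h1.trans hjk, h2, fun v hv => h3 v (hYX hv)⟩

theorem PathCoverable.biUnion {ι : Type*} {E : V → V → Prop} (s : Finset ι) {X : ι → Set V}
    {k : ι → ℕ} (h : ∀ i ∈ s, PathCoverable E (X i) (k i)) :
    PathCoverable E (⋃ i ∈ s, X i) (∑ i ∈ s, k i) := by
  classical
  induction s using Finset.induction_on with
  | empty => exact ⟨[], by simp, by simp, by simp⟩
  | insert i s hi ih =>
    rw [Finset.set_biUnion_insert, Finset.sum_insert hi]
    exact (h i (by simp)).union (ih fun j hj => h j (by simp [hj]))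

theorem PathCoverable.of_flip {E : V → V → Prop} {X : Set V} {k : ℕ}
    (h : PathCoverable (fun a b => E b a) X k) : PathCoverable E X k := by
  obtain ⟨F, h1, h2, h3⟩ := h
  refine ⟨F.map List.reverse, by simpa using h1, ?_, ?_⟩
  · intro l hl
    obtain ⟨l', hl', rfl⟩ := List.mem_map.1 hl
    rw [List.nodup_reverse, List.isChain_reverse]
    exact h2 l' hl'
  · intro v hv
    obtain ⟨l, hl, hvl⟩ := h3 v hv
    exact ⟨_, List.mem_map.2 ⟨l, hl, rfl⟩, List.mem_reverse.2 hvl⟩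

theorem PathCoverable.pcOn_univ_le {E : V → V → Prop} {k : ℕ}
    (h : PathCoverable E Set.univ k) : pcOn E Set.univ ≤ k := by
  classical
  obtain ⟨F, h1, h2, h3⟩ := h
  have hle : pcOn E Set.univ ≤ (F.toFinset.filter (· ≠ [])).card := by
    refine Nat.sInf_le ⟨_, rfl, ?_, ?_⟩
    · intro l hl
      simp only [Finset.mem_filter, List.mem_toFinset] at hl
      exact ⟨⟨hl.2, h2 l hl.1⟩, fun _ _ => trivial⟩
    · intro v hv
      obtain ⟨l, hl, hvl⟩ := h3 v hv
      refine ⟨l, ?_, hvl⟩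
      simp only [Finset.mem_filter, List.mem_toFinset]
      exact ⟨hl, List.ne_nil_of_mem hvl⟩
  exact hle.trans ((Finset.card_filter_le _ _).trans ((List.toFinset_card_le F).trans h1))

end PathCovers

section Ramsey

theorem exists_ramsey (a b : ℕ) : ∃ R : ℕ, ∀ {V : Type} (G : SimpleGraph V) (S : Finset V),
    R ≤ S.card → (∃ s ⊆ S, G.IsNClique a s) ∨ (∃ s ⊆ S, Gᶜ.IsNClique b s) := by
  classical
  induction a generalizing b with
  | zero => exact ⟨0, fun G S _ => Or.inl ⟨∅, by simp, by simp⟩⟩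
  | succ a iha =>
    induction b with
    | zero => exact ⟨0, fun G S _ => Or.inr ⟨∅, by simp, by simp⟩⟩
    | succ b ihb =>
      obtain ⟨R₁, h₁⟩ := iha (b + 1)
      obtain ⟨R₂, h₂⟩ := ihb
      refine ⟨R₁ + R₂ + 1, fun {V} G S hS => ?_⟩
      obtain ⟨v, hv⟩ : S.Nonempty := Finset.card_pos.1 (by omega)
      have hsplit := Finset.card_filter_add_card_filter_not (s := S.erase v) (fun x => G.Adj v x)
      rw [Finset.card_erase_of_mem hv] at hsplit
      have hsub : ∀ (p : V → Prop) [DecidablePred p], (S.erase v).filter p ⊆ S :=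
        fun p _ => (Finset.filter_subset _ _).trans (Finset.erase_subset _ _)
      rcases Nat.lt_or_ge ((S.erase v).filter (fun x => G.Adj v x)).card R₁ with hlt | hge
      · rcases h₂ G ((S.erase v).filter fun x => ¬ G.Adj v x) (by omega) with
          ⟨s, hs, hc⟩ | ⟨s, hs, hc⟩
        · exact Or.inl ⟨s, hs.trans (hsub _), hc⟩
        · refine Or.inr ⟨insert v s, Finset.insert_subset hv (hs.trans (hsub _)),
            hc.insert fun x hx => ?_⟩
          have := hs hx
          simp only [Finset.mem_filter, Finset.mem_erase] at this
          rw [SimpleGraph.compl_adj]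
          exact ⟨fun h => this.1.1 h.symm, this.2⟩
      · rcases h₁ G ((S.erase v).filter fun x => G.Adj v x) hge with ⟨s, hs, hc⟩ | ⟨s, hs, hc⟩
        · refine Or.inl ⟨insert v s, Finset.insert_subset hv (hs.trans (hsub _)),
            hc.insert fun x hx => ?_⟩
          have := hs hx
          simp only [Finset.mem_filter] at this
          exact this.2
        · exact Or.inr ⟨s, hs.trans (hsub _), hc⟩

theorem ramseyNumber_spec (a b m : ℕ) (hm : ramseyNumber a b ≤ m) (G : SimpleGraph (Fin m)) :
    (∃ s : Finset (Fin m), G.IsNClique a s) ∨ (∃ s : Finset (Fin m), Gᶜ.IsNClique b s) := by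
  have hne : {R | ∀ m : ℕ, R ≤ m → ∀ G : SimpleGraph (Fin m),
      (∃ s : Finset (Fin m), G.IsNClique a s) ∨
        (∃ s : Finset (Fin m), Gᶜ.IsNClique b s)}.Nonempty := by
    obtain ⟨R, hR⟩ := exists_ramsey a b
    refine ⟨R, fun m hm G => ?_⟩
    rcases hR G Finset.univ (by simpa using hm) with ⟨s, -, hs⟩ | ⟨s, -, hs⟩
    · exact Or.inl ⟨s, hs⟩
    · exact Or.inr ⟨s, hs⟩
  exact Nat.sInf_mem hne m hm G

theorem exists_clique_or_indep {V : Type} (G : SimpleGraph V) (a b : ℕ) (S : Finset V)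
    (hS : ramseyNumber a b ≤ S.card) :
    (∃ f : Fin a → V, Function.Injective f ∧ (∀ i, f i ∈ S) ∧ ∀ i j, i ≠ j → G.Adj (f i) (f j)) ∨
      ∃ s ⊆ S, s.card = b ∧ ∀ x ∈ s, ∀ y ∈ s, ¬ G.Adj x y := by
  classical
  let e : Fin S.card ↪ V := S.equivFin.symm.toEmbedding.trans (Function.Embedding.subtype _)
  have he : ∀ i, e i ∈ S := fun i => (S.equivFin.symm i).2
  rcases ramseyNumber_spec a b S.card hS (G.comap e) with ⟨s, hs⟩ | ⟨s, hs⟩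
  · left
    let g := s.orderEmbOfFin hs.card_eq
    refine ⟨fun i => e (g i), e.injective.comp g.injective, fun i => he _, fun i j hij => ?_⟩
    have := hs.isClique (Finset.orderEmbOfFin_mem s hs.card_eq i)
      (Finset.orderEmbOfFin_mem s hs.card_eq j) (g.injective.ne hij)
    simpa using this
  · right
    refine ⟨s.map e, ?_, by rw [Finset.card_map, hs.card_eq], ?_⟩
    · intro x hx
      obtain ⟨i, -, rfl⟩ := Finset.mem_map.1 hx
      exact he i
    · intro x hx y hy hxy
      obtain ⟨i, hi, rfl⟩ := Finset.mem_map.1 hx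
      obtain ⟨j, hj, rfl⟩ := Finset.mem_map.1 hy
      have hij : i ≠ j := by rintro rfl; exact G.loopless.irrefl _ hxy
      have := hs.isClique hi hj hij
      rw [SimpleGraph.compl_adj] at this
      exact this.2 (by simpa using hxy)

/-- Disjoint cliques witness a linear lower bound for Ramsey numbers. -/
theorem lt_ramseyNumber (q b : ℕ) (hq : 0 < q) : q * b < ramseyNumber (q + 1) (b + 1) := by
  classical
  by_contra hle
  push Not at hle
  let G : SimpleGraph (Fin (q * b)) := SimpleGraph.mk (fun i j => i ≠ j ∧ i.val / q = j.val / q)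
    ⟨fun i j h => ⟨h.1.symm, h.2.symm⟩⟩ ⟨fun i h => h.1 rfl⟩
  rcases ramseyNumber_spec _ _ _ hle G with ⟨s, hs⟩ | ⟨s, hs⟩
  · have hinj : Set.InjOn (fun i : Fin (q * b) => i.val % q) s := by
      intro i hi j hj hij
      by_contra hne
      have hd : i.val / q = j.val / q := (hs.isClique hi hj hne).2
      have h1 := Nat.div_add_mod i.val q
      have h2 := Nat.div_add_mod j.val q
      simp only at hij
      rw [hd, hij] at h1
      exact hne (Fin.ext (by omega))
    have := Finset.card_le_card_of_injOn (t := Finset.range q) _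
      (fun i _ => by simpa using Nat.mod_lt _ hq) hinj
    rw [hs.card_eq, Finset.card_range] at this
    omega
  · have hinj : Set.InjOn (fun i : Fin (q * b) => i.val / q) s := by
      intro i hi j hj hij
      by_contra hne
      have := hs.isClique hi hj hne
      rw [SimpleGraph.compl_adj] at this
      exact this.2 ⟨hne, hij⟩
    have := Finset.card_le_card_of_injOn (t := Finset.range b) _
      (fun i _ => by simpa using Nat.div_lt_of_lt_mul i.2) hinj
    rw [hs.card_eq, Finset.card_range] at this
    omega

end Ramsey

section Domination

variable {V : Type} {E : V → V → Prop} {n : ℕ}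

theorem adj_fromRel_iff (hE : ∀ u v : V, E u v → ¬ E v u) (u v : V) :
    (SimpleGraph.fromRel E).Adj u v ↔ E u v ∨ E v u := by
  rw [SimpleGraph.fromRel_adj]
  refine ⟨fun h => h.2, fun h => ⟨?_, h⟩⟩
  rintro rfl
  rcases h with h | h <;> exact hE _ _ h h

/-- In a `K_{1,n}`-free graph, neighborhoods contain no independent set of size `n`. -/
theorem card_lt_of_star_free {G : SimpleGraph V} (hstar : ¬ HasInducedCopyG (StarG n) G)
    (c : V) (S : Finset V) (hS : ∀ a ∈ S, G.Adj c a) (hind : ∀ a ∈ S, ∀ b ∈ S, ¬ G.Adj a b) :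
    S.card < n := by
  by_contra hle
  push Not at hle
  obtain ⟨T, hTS, hT⟩ := Finset.exists_subset_card_eq hle
  let g : Fin n → V := fun i => T.equivFin.symm (Fin.cast hT.symm i)
  have hg : ∀ i, g i ∈ S := fun i => hTS (T.equivFin.symm _).2
  have hginj : Function.Injective g := fun i j hij => by
    simpa [g, Subtype.ext_iff.symm] using hij
  refine hstar ⟨Sum.elim (fun _ => c) g, ?_, ?_⟩
  · rintro (⟨⟩ | i) (⟨⟩ | j) h
    · rfl
    · exact absurd h (hS _ (hg j)).ne
    · exact absurd h.symm (hS _ (hg i)).ne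
    · exact congrArg _ (hginj h)
  · rintro (⟨⟩ | i) (⟨⟩ | j)
    · simp [StarG]
    · simp [StarG, hS _ (hg j)]
    · simp [StarG, (hS _ (hg i)).symm]
    · simp [StarG, hind _ (hg i) _ (hg j)]

/-- If every vertex of `Y` has a neighbor in `X`, the independence number of `Y` is bounded in
terms of that of `X`. -/
theorem IndepBound.of_dominated (hn : 2 ≤ n) (hE : ∀ u v : V, E u v → ¬ E v u)
    (hK : ¬ HasInducedCopyG (KStarG n) (SimpleGraph.fromRel E))
    (hstar : ¬ HasInducedCopyG (StarG n) (SimpleGraph.fromRel E)) {X Y : Set V} {k : ℕ}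
    (hX : IndepBound E X k)
    (hdom : ∀ y ∈ Y, ∃ x ∈ X, (SimpleGraph.fromRel E).Adj x y) :
    IndepBound E Y ((n - 1) * ramseyNumber n (k + 1) - 1) := by
  classical
  set G := SimpleGraph.fromRel E with hG
  have hadj := adj_fromRel_iff hE
  rw [← hG] at hadj
  intro S hSY hSind
  by_contra hlt
  push Not at hlt
  have hSind' : ∀ a ∈ S, ∀ b ∈ S, ¬ G.Adj a b := fun a ha b hb h =>
    ((hadj a b).1 h).elim (hSind a ha b hb) (hSind b hb a ha)
  choose! f hfX hf using hdom
  -- a minimal subset of `X` dominating `S`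
  have hex : ∃ T : Finset V, (∀ x ∈ T, x ∈ X) ∧ (∀ y ∈ S, ∃ x ∈ T, G.Adj x y) ∧
      ∀ T' ⊂ T, ¬ ∀ y ∈ S, ∃ x ∈ T', G.Adj x y := by
    have h0 : ∃ N, ∃ T : Finset V, T.card = N ∧ (∀ x ∈ T, x ∈ X) ∧
        ∀ y ∈ S, ∃ x ∈ T, G.Adj x y :=
      ⟨_, S.image f, rfl, by
        intro x hx
        obtain ⟨y, hy, rfl⟩ := Finset.mem_image.1 hx
        exact hfX y (hSY y hy),
        fun y hy => ⟨f y, Finset.mem_image_of_mem f hy, hf y (hSY y hy)⟩⟩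
    obtain ⟨T, hT, hTX, hTd⟩ := Nat.find_spec h0
    refine ⟨T, hTX, hTd, fun T' hT' hd => ?_⟩
    exact Nat.find_min h0 (hT ▸ Finset.card_lt_card hT')
      ⟨T', rfl, fun x hx => hTX x (hT'.1 hx), hd⟩
  obtain ⟨T, hTX, hTd, hTmin⟩ := hex
  have hpriv : ∀ x ∈ T, ∃ y ∈ S, G.Adj x y ∧ ∀ x' ∈ T, x' ≠ x → ¬ G.Adj x' y := by
    intro x hx
    have := hTmin (T.erase x) (Finset.erase_ssubset hx)
    push Not at this
    obtain ⟨y, hy, hyn⟩ := this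
    obtain ⟨x', hx', hx'y⟩ := hTd y hy
    have hxx' : x' = x := by
      by_contra hne
      exact hyn x' (Finset.mem_erase.2 ⟨hne, hx'⟩) hx'y
    exact ⟨y, hy, hxx' ▸ hx'y, fun z hz hzx => hyn z (Finset.mem_erase.2 ⟨hzx, hz⟩)⟩
  have hcard : S.card ≤ T.card * (n - 1) := by
    have hSsub : S ⊆ T.biUnion fun x => S.filter fun y => G.Adj x y := by
      intro y hy
      obtain ⟨x, hx, hxy⟩ := hTd y hy
      exact Finset.mem_biUnion.2 ⟨x, hx, Finset.mem_filter.2 ⟨hy, hxy⟩⟩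
    refine (Finset.card_le_card hSsub).trans (Finset.card_biUnion_le_card_mul _ _ _ ?_)
    intro x _
    have := card_lt_of_star_free hstar x (S.filter fun y => G.Adj x y)
      (fun a ha => (Finset.mem_filter.1 ha).2)
      (fun a ha b hb => hSind' a (Finset.mem_filter.1 ha).1 b (Finset.mem_filter.1 hb).1)
    omega
  have hR : ramseyNumber n (k + 1) ≤ T.card := by
    have h1 : (n - 1) * ramseyNumber n (k + 1) ≤ (n - 1) * T.card := by
      rw [mul_comm _ T.card]; omega
    exact Nat.le_of_mul_le_mul_left h1 (by omega)
  rcases exists_clique_or_indep G n (k + 1) T hR with ⟨g, hginj, hgT, hgadj⟩ | ⟨s, hsT, hsc, hs⟩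
  · choose! y hyS hxy hyuniq using hpriv
    have hgy : ∀ i j, G.Adj (g i) (y (g j)) ↔ i = j := by
      intro i j
      refine ⟨fun h => ?_, ?_⟩
      · by_contra hij
        exact hyuniq _ (hgT j) _ (hgT i) (hginj.ne hij) h
      · rintro rfl; exact hxy _ (hgT i)
    have hgney : ∀ i j, g i ≠ y (g j) := by
      intro i j h
      exact hSind' (y (g j)) (hyS _ (hgT j)) (y (g i)) (hyS _ (hgT i))
        (h ▸ (hgy i i).2 rfl)
    refine hK ⟨Sum.elim g fun i => y (g i), ?_, ?_⟩
    · rintro (i | i) (j | j) h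
      · exact congrArg _ (hginj h)
      · exact absurd h (hgney i j)
      · exact absurd h.symm (hgney j i)
      · simp only [Sum.elim_inr] at h
        exact congrArg _ ((hgy i j).1 (h ▸ (hgy i i).2 rfl))
    · rintro (i | i) (j | j)
      · by_cases hij : i = j
        · subst hij; simp [KStarG]
        · simp [KStarG, hgadj i j hij, hij]
      · simp [KStarG, hgy i j]
      · rw [SimpleGraph.adj_comm]
        simp [KStarG, hgy j i]
      · have := hSind' (y (g i)) (hyS _ (hgT i)) (y (g j)) (hyS _ (hgT j))
        simp [KStarG, this]
  · have := hX s (fun a ha => hTX a (hsT ha))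
      (fun a ha b hb h => hs a ha b hb ((hadj a b).2 (Or.inl h)))
    omega

end Domination

section InducedPaths

variable {V : Type}

/-- The first `m` terms of `u` form an induced path of `G`. -/
structure InducedPath (G : SimpleGraph V) (u : ℕ → V) (m : ℕ) : Prop where
  inj : ∀ s < m, ∀ t < m, u s = u t → s = t
  adj : ∀ s < m, ∀ t < m, (G.Adj (u s) (u t) ↔ s + 1 = t ∨ t + 1 = s)

/-- The sequence `x, g 0, g 1, …`. -/
def consSeq (x : V) (g : ℕ → V) : ℕ → V
  | 0 => x
  | t + 1 => g t

variable {G : SimpleGraph V} {n m : ℕ} {u : ℕ → V}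

namespace InducedPath

theorem up (hP : InducedPath G u m) {j k : ℕ} (hj : j + k ≤ m) :
    InducedPath G (fun t => u (j + t)) k where
  inj s hs t ht h := by have := hP.inj _ (by omega) _ (by omega) h; omega
  adj s hs t ht := by rw [hP.adj _ (by omega) _ (by omega)]; omega

theorem down (hP : InducedPath G u m) {i k : ℕ} (hi : i < m) (hk : k ≤ i + 1) :
    InducedPath G (fun t => u (i - t)) k where
  inj s hs t ht h := by have := hP.inj _ (by omega) _ (by omega) h; omega
  adj s hs t ht := by rw [hP.adj _ (by omega) _ (by omega)]; omega

theorem reverse (hP : InducedPath G u m) : InducedPath G (fun t => u (m - 1 - t)) m where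
  inj s hs t ht h := by have := hP.inj _ (by omega) _ (by omega) h; omega
  adj s hs t ht := by rw [hP.adj _ (by omega) _ (by omega)]; omega

theorem cons (hP : InducedPath G u m) {x : V} (h0 : G.Adj x (u 0))
    (h : ∀ t < m, 1 ≤ t → x ≠ u t ∧ ¬ G.Adj x (u t)) : InducedPath G (consSeq x u) (m + 1) where
  inj s hs t ht he := by
    have hne : ∀ t, t + 1 < m + 1 → x ≠ u t := by
      intro t ht
      rcases Nat.eq_zero_or_pos t with rfl | hpos
      · exact h0.ne
      · exact (h t (by omega) hpos).1
    cases s with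
    | zero => cases t with
      | zero => rfl
      | succ t => exact absurd he (hne t ht)
    | succ s => cases t with
      | zero => exact absurd he.symm (hne s hs)
      | succ t => rw [hP.inj s (by omega) t (by omega) he]
  adj s hs t ht := by
    have hx : ∀ t, t + 1 < m + 1 → (G.Adj x (u t) ↔ t = 0) := by
      intro t ht
      rcases Nat.eq_zero_or_pos t with rfl | hpos
      · simp [h0]
      · simp only [(h t (by omega) hpos).2, false_iff]; omega
    cases s with
    | zero => cases t with
      | zero => simp
      | succ t => exact (hx t ht).trans (by omega)
    | succ s => cases t with
      | zero => rw [G.adj_comm]; exact (hx s hs).trans (by omega)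
      | succ t => exact (hP.adj s (by omega) t (by omega)).trans (by omega)

end InducedPath

/-- A vertex `x₁` with a neighbor `x₂` and two long induced paths attached to it yields an induced
copy of `F^(1)_n` or of `F^(2)_n`. -/
theorem not_fork (hF1 : ¬ HasInducedCopyG (F1G n) G) (hF2 : ¬ HasInducedCopyG (F2G n) G)
    {y z : ℕ → V} {x₁ x₂ : V} (hy : InducedPath G y n) (hz : InducedPath G z n)
    (hx : G.Adj x₁ x₂) (hxy : ∀ t < n, G.Adj x₁ (y t) ↔ t = 0)
    (hxz : ∀ t < n, G.Adj x₁ (z t) ↔ t = 0) (hx₂y : ∀ t < n, x₂ ≠ y t ∧ ¬ G.Adj x₂ (y t))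
    (hx₂z : ∀ t < n, x₂ ≠ z t ∧ ¬ G.Adj x₂ (z t))
    (hyz : ∀ s < n, ∀ t < n, y s ≠ z t ∧ (G.Adj (y s) (z t) → s = 0 ∧ t = 0)) : False := by
  have hx₁y : ∀ t < n, x₁ ≠ y t := fun t ht h => (hx₂y t ht).2 (h ▸ hx.symm)
  have hx₁z : ∀ t < n, x₁ ≠ z t := fun t ht h => (hx₂z t ht).2 (h ▸ hx.symm)
  let f : Fin 2 ⊕ Fin n ⊕ Fin n → V :=
    Sum.elim (fun i => if i.val = 0 then x₁ else x₂) (Sum.elim (fun i => y i) fun i => z i)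
  have hf0 : f (Sum.inl 0) = x₁ := rfl
  have hf1 : f (Sum.inl 1) = x₂ := rfl
  have hfy : ∀ i, f (Sum.inr (Sum.inl i)) = y i := fun i => rfl
  have hfz : ∀ i, f (Sum.inr (Sum.inr i)) = z i := fun i => rfl
  have hfin : ∀ i : Fin 2, i = 0 ∨ i = 1 := by decide
  have hinj : Function.Injective f := by
    rintro (i | i | i) (j | j | j) h
    · rcases hfin i with rfl | rfl <;> rcases hfin j with rfl | rfl
      · rfl
      · exact absurd h hx.ne
      · exact absurd h.symm hx.ne
      · rfl
    · rcases hfin i with rfl | rfl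
      · exact absurd h (hx₁y j j.2)
      · exact absurd h (hx₂y j j.2).1
    · rcases hfin i with rfl | rfl
      · exact absurd h (hx₁z j j.2)
      · exact absurd h (hx₂z j j.2).1
    · rcases hfin j with rfl | rfl
      · exact absurd h.symm (hx₁y i i.2)
      · exact absurd h.symm (hx₂y i i.2).1
    · exact congrArg _ (congrArg _ (Fin.ext (hy.inj i i.2 j j.2 h)))
    · exact absurd h (hyz i i.2 j j.2).1
    · rcases hfin j with rfl | rfl
      · exact absurd h.symm (hx₁z i i.2)
      · exact absurd h.symm (hx₂z i i.2).1
    · exact absurd h.symm (hyz j j.2 i i.2).1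
    · exact congrArg _ (congrArg _ (Fin.ext (hz.inj i i.2 j j.2 h)))
  have hnepath : ∀ i j : Fin n, (i.val + 1 = j.val ∨ j.val + 1 = i.val) → i ≠ j := by
    rintro i j h rfl; omega
  have hyy : ∀ i j : Fin n, G.Adj (y i) (y j) ↔ i ≠ j ∧ (i.val + 1 = j.val ∨ j.val + 1 = i.val) :=
    fun i j => (hy.adj i i.2 j j.2).trans ⟨fun h => ⟨hnepath i j h, h⟩, fun h => h.2⟩
  have hzz : ∀ i j : Fin n, G.Adj (z i) (z j) ↔ i ≠ j ∧ (i.val + 1 = j.val ∨ j.val + 1 = i.val) :=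
    fun i j => (hz.adj i i.2 j j.2).trans ⟨fun h => ⟨hnepath i j h, h⟩, fun h => h.2⟩
  have key : ∀ H : SimpleGraph (Fin 2 ⊕ Fin n ⊕ Fin n),
      (∀ i j, H.Adj (Sum.inr (Sum.inl i)) (Sum.inr (Sum.inr j)) ↔ G.Adj (y i) (z j)) →
      (∀ a b, (F1G n).Adj a b → H.Adj a b) →
      (∀ a b, H.Adj a b → (F1G n).Adj a b ∨
        (∃ i j, a = Sum.inr (Sum.inl i) ∧ b = Sum.inr (Sum.inr j)) ∨
        (∃ i j, b = Sum.inr (Sum.inl i) ∧ a = Sum.inr (Sum.inr j))) →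
      HasInducedCopyG H G := by
    intro H hH hle hge
    refine ⟨f, hinj, ?_⟩
    have hbase : ∀ a b, ¬ (∃ i j, a = Sum.inr (Sum.inl i) ∧ b = Sum.inr (Sum.inr j)) →
        ¬ (∃ i j, b = Sum.inr (Sum.inl i) ∧ a = Sum.inr (Sum.inr j)) →
        (H.Adj a b ↔ (F1G n).Adj a b) := by
      intro a b h1 h2
      refine ⟨fun h => ?_, hle a b⟩
      rcases hge a b h with h | h | h
      · exact h
      · exact absurd h h1
      · exact absurd h h2
    rintro (i | i | i) (j | j | j)
    · rw [hbase _ _ (by simp) (by simp)]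
      rcases hfin i with rfl | rfl <;> rcases hfin j with rfl | rfl <;>
        simp [hf0, hf1, F1G, hx, hx.symm]
    · rw [hbase _ _ (by simp) (by simp), hfy]
      rcases hfin i with rfl | rfl
      · rw [hf0, hxy j j.2]; simp [F1G]
      · rw [hf1]; simp [F1G, (hx₂y j j.2).2]
    · rw [hbase _ _ (by simp) (by simp), hfz]
      rcases hfin i with rfl | rfl
      · rw [hf0, hxz j j.2]; simp [F1G]
      · rw [hf1]; simp [F1G, (hx₂z j j.2).2]
    · rw [hbase _ _ (by simp) (by simp), hfy, G.adj_comm]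
      rcases hfin j with rfl | rfl
      · rw [hf0, hxy i i.2]; simp [F1G]
      · rw [hf1]; simp [F1G, (hx₂y i i.2).2]
    · rw [hbase _ _ (by simp) (by simp), hfy, hfy, hyy]; simp [F1G]
    · rw [hH, hfy, hfz]
    · rw [hbase _ _ (by simp) (by simp), hfz, G.adj_comm]
      rcases hfin j with rfl | rfl
      · rw [hf0, hxz i i.2]; simp [F1G]
      · rw [hf1]; simp [F1G, (hx₂z i i.2).2]
    · rw [G.adj_comm, H.adj_comm, hH, hfy, hfz]
    · rw [hbase _ _ (by simp) (by simp), hfz, hfz, hzz]; simp [F1G]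
  by_cases h00 : ∃ _ : 0 < n, G.Adj (y 0) (z 0)
  · refine hF2 (key _ ?_ ?_ ?_)
    · intro i j
      have hiff : G.Adj (y i) (z j) ↔ i.val = 0 ∧ j.val = 0 := by
        refine ⟨(hyz i i.2 j j.2).2, fun h => ?_⟩
        rw [h.1, h.2]; exact h00.2
      rw [hiff]; simp [F2G, F1G, YZEdgeG]
    · intro a b h; exact Or.inl h
    · rintro a b (h | h)
      · exact Or.inl h
      · rcases a with a | a | a <;> rcases b with b | b | b <;> simp [YZEdgeG] at h ⊢
  · refine hF1 (key _ ?_ (fun _ _ h => h) fun _ _ h => Or.inl h)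
    intro i j
    have : ¬ G.Adj (y i) (z j) := by
      intro h
      have := (hyz i i.2 j j.2).2 h
      rw [this.1, this.2] at h
      exact h00 ⟨by have := i.2; omega, h⟩
    simp [this, F1G]

section Middle

variable (hF1 : ¬ HasInducedCopyG (F1G n) G) (hF2 : ¬ HasInducedCopyG (F2G n) G)
  (hP : InducedPath G u m) {v : V}
include hF1 hF2 hP

theorem not_outer_neighbor {i j : ℕ} (hi : n ≤ i + 1) (hij : i < j) (hjm : j + n ≤ m)
    (hvi : G.Adj v (u i)) (hvj : G.Adj v (u j)) (hmin : ∀ t < m, G.Adj v (u t) → i ≤ t)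
    (hmax : ∀ t < m, G.Adj v (u t) → t ≤ j) {x : V} (hvx : G.Adj v x)
    (hx : ∀ t < m, (t ≤ i ∨ j ≤ t ∧ t < j + n) → x ≠ u t ∧ ¬ G.Adj x (u t)) : False := by
  refine not_fork hF1 hF2 (hP.down (i := i) (k := n) (by omega) (by omega))
    (hP.up (j := j) (k := n) (by omega)) (x₁ := v) (x₂ := x) hvx ?_ ?_ ?_ ?_ ?_
  · intro t ht
    refine ⟨fun h => ?_, fun h => by simpa [h] using hvi⟩
    have := hmin _ (by omega) h; omega
  · intro t ht
    refine ⟨fun h => ?_, fun h => by simpa [h] using hvj⟩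
    have := hmax _ (by omega) h; omega
  · intro t ht; exact hx _ (by omega) (by omega)
  · intro t ht; exact hx _ (by omega) (by omega)
  · intro s hs t ht
    refine ⟨fun h => ?_, fun h => ?_⟩
    · have := hP.inj _ (by omega) _ (by omega) h; omega
    · rw [hP.adj _ (by omega) _ (by omega)] at h; omega

variable (hv : ∀ t < m, v ≠ u t)
include hv

theorem not_unique_neighbor {i : ℕ} (hi : n ≤ i) (him : i + n < m)
    (hvi : ∀ t < m, G.Adj v (u t) ↔ t = i) : False := by
  refine not_fork hF1 hF2 (hP.down (i := i - 1) (k := n) (by omega) (by omega))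
    (hP.up (j := i + 1) (k := n) (by omega)) (x₁ := u i) (x₂ := v)
    ((hvi i (by omega)).2 rfl).symm ?_ ?_ ?_ ?_ ?_
  · intro t ht; rw [hP.adj _ (by omega) _ (by omega)]; omega
  · intro t ht; rw [hP.adj _ (by omega) _ (by omega)]; omega
  · intro t ht; rw [hvi _ (by omega)]; exact ⟨hv _ (by omega), by omega⟩
  · intro t ht; rw [hvi _ (by omega)]; exact ⟨hv _ (by omega), by omega⟩
  · intro s hs t ht
    refine ⟨fun h => ?_, fun h => ?_⟩
    · have := hP.inj _ (by omega) _ (by omega) h; omega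
    · rw [hP.adj _ (by omega) _ (by omega)] at h; omega

/-- The neighbors on an induced path of a vertex attached to its middle part are confined to at
most four consecutive vertices. -/
theorem neighbors_span {i j : ℕ} (hi : n ≤ i) (hjm : j + n < m)
    (hvi : G.Adj v (u i)) (hvj : G.Adj v (u j)) (hmin : ∀ t < m, G.Adj v (u t) → i ≤ t)
    (hmax : ∀ t < m, G.Adj v (u t) → t ≤ j) : i < j ∧ j ≤ i + 3 := by
  have hij : i ≤ j := hmin j (by omega) hvj
  have hlt : i < j := by
    rcases Nat.lt_or_ge i j with h | h
    · exact h
    · exfalso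
      have hij' : i = j := by omega
      subst hij'
      refine not_unique_neighbor hF1 hF2 hP hv hi hjm fun t ht => ⟨fun h => ?_, ?_⟩
      · have := hmin t ht h; have := hmax t ht h; omega
      · rintro rfl; exact hvi
  refine ⟨hlt, ?_⟩
  by_contra hspan
  have hz : InducedPath G (consSeq v fun t => u (j + t)) (n + 1) := by
    refine (hP.up (j := j) (k := n) (by omega)).cons hvj fun t ht h1 => ⟨hv _ (by omega), fun h => ?_⟩
    have := hmax _ (by omega) h; omega
  have hz' : InducedPath G (consSeq v fun t => u (j + t)) n :=
    ⟨fun s hs t ht => hz.inj s (by omega) t (by omega),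
      fun s hs t ht => hz.adj s (by omega) t (by omega)⟩
  by_cases h1 : G.Adj v (u (i + 1))
  · by_cases h2 : G.Adj v (u (i + 2))
    · refine not_outer_neighbor hF1 hF2 hP (by omega) hlt (by omega) hvi hvj hmin hmax h2 ?_
      intro t ht htt
      refine ⟨fun h => ?_, fun h => ?_⟩
      · have := hP.inj _ (by omega) _ (by omega) h; omega
      · rw [hP.adj _ (by omega) _ (by omega)] at h; omega
    · refine not_fork hF1 hF2 (hP.down (i := i) (k := n) (by omega) (by omega)) hz'
        (x₁ := u (i + 1)) (x₂ := u (i + 2)) ((hP.adj _ (by omega) _ (by omega)).2 (by omega))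
        ?_ ?_ ?_ ?_ ?_
      · intro t ht; rw [hP.adj _ (by omega) _ (by omega)]; omega
      · rintro (_ | t) ht
        · simp [consSeq, h1.symm]
        · simp only [consSeq]; rw [hP.adj _ (by omega) _ (by omega)]; omega
      · intro t ht
        refine ⟨fun h => ?_, fun h => ?_⟩
        · have := hP.inj _ (by omega) _ (by omega) h; omega
        · rw [hP.adj _ (by omega) _ (by omega)] at h; omega
      · rintro (_ | t) ht
        · exact ⟨(hv _ (by omega)).symm, fun h => h2 h.symm⟩
        · simp only [consSeq]
          refine ⟨fun h => ?_, fun h => ?_⟩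
          · have := hP.inj _ (by omega) _ (by omega) h; omega
          · rw [hP.adj _ (by omega) _ (by omega)] at h; omega
      · rintro s hs (_ | t) ht
        · refine ⟨(hv _ (by omega)).symm, fun h => ?_⟩
          have := hmin _ (by omega) h.symm; omega
        · simp only [consSeq]
          refine ⟨fun h => ?_, fun h => ?_⟩
          · have := hP.inj _ (by omega) _ (by omega) h; omega
          · rw [hP.adj _ (by omega) _ (by omega)] at h; omega
  · refine not_fork hF1 hF2 (hP.down (i := i - 1) (k := n) (by omega) (by omega)) hz'
      (x₁ := u i) (x₂ := u (i + 1)) ((hP.adj _ (by omega) _ (by omega)).2 (by omega))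
      ?_ ?_ ?_ ?_ ?_
    · intro t ht; rw [hP.adj _ (by omega) _ (by omega)]; omega
    · rintro (_ | t) ht
      · simp [consSeq, hvi.symm]
      · simp only [consSeq]; rw [hP.adj _ (by omega) _ (by omega)]; omega
    · intro t ht
      refine ⟨fun h => ?_, fun h => ?_⟩
      · have := hP.inj _ (by omega) _ (by omega) h; omega
      · rw [hP.adj _ (by omega) _ (by omega)] at h; omega
    · rintro (_ | t) ht
      · exact ⟨(hv _ (by omega)).symm, fun h => h1 h.symm⟩
      · simp only [consSeq]
        refine ⟨fun h => ?_, fun h => ?_⟩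
        · have := hP.inj _ (by omega) _ (by omega) h; omega
        · rw [hP.adj _ (by omega) _ (by omega)] at h; omega
    · rintro s hs (_ | t) ht
      · refine ⟨(hv _ (by omega)).symm, fun h => ?_⟩
        have := hmin _ (by omega) h.symm; omega
      · simp only [consSeq]
        refine ⟨fun h => ?_, fun h => ?_⟩
        · have := hP.inj _ (by omega) _ (by omega) h; omega
        · rw [hP.adj _ (by omega) _ (by omega)] at h; omega

end Middle

end InducedPaths

section Layers

variable {V : Type} {G : SimpleGraph V} {n m L : ℕ} {u : ℕ → V} {δ : V → ℕ}

/-- `δ` behaves like the distance to the set of the first `m` terms of `u`. -/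
structure LayerFn (G : SimpleGraph V) (u : ℕ → V) (m : ℕ) (δ : V → ℕ) : Prop where
  zero_iff : ∀ v, δ v = 0 ↔ ∃ p < m, v = u p
  le_succ : ∀ v w, G.Adj v w → δ w ≤ δ v + 1
  exists_pred : ∀ v k, δ v = k + 1 → ∃ w, G.Adj v w ∧ δ w = k

theorem exists_layerFn (hG : G.Connected) (hm : 0 < m) : ∃ δ, LayerFn G u m δ := by
  let δ : V → ℕ := fun v => sInf {d | ∃ p < m, G.dist v (u p) = d}
  have hmem : ∀ v, ∃ p < m, G.dist v (u p) = δ v := fun v => Nat.sInf_mem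
    (s := {d | ∃ p < m, G.dist v (u p) = d}) ⟨_, 0, hm, rfl⟩
  have hle : ∀ v, ∀ p < m, δ v ≤ G.dist v (u p) := fun v p hp => Nat.sInf_le ⟨p, hp, rfl⟩
  have hsucc : ∀ v w, G.Adj v w → δ w ≤ δ v + 1 := by
    intro v w h
    obtain ⟨p, hp, hpd⟩ := hmem v
    have h1 := hG.dist_triangle (u := w) (v := v) (w := u p)
    have h2 := hle w p hp
    have h3 : G.dist w v = 1 := SimpleGraph.dist_eq_one_iff_adj.2 h.symm
    omega
  refine ⟨δ, ?_, hsucc, ?_⟩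
  · intro v
    constructor
    · intro h
      obtain ⟨p, hp, hpd⟩ := hmem v
      exact ⟨p, hp, hG.dist_eq_zero_iff.1 (by omega)⟩
    · rintro ⟨p, hp, rfl⟩
      have := hle (u p) p hp
      rw [SimpleGraph.dist_self] at this
      omega
  · intro v k hk
    obtain ⟨p, hp, hpd⟩ := hmem v
    obtain ⟨W, hW⟩ := hG.exists_walk_length_eq_dist v (u p)
    rw [hpd, hk] at hW
    cases W with
    | nil => simp at hW
    | @cons _ w _ h W =>
      refine ⟨_, h, ?_⟩
      simp only [SimpleGraph.Walk.length_cons, Nat.add_right_cancel_iff] at hW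
      have h1 := SimpleGraph.dist_le W
      have h2 := hle w p hp
      have h3 := hsucc _ _ h.symm
      omega

theorem exists_extreme_neighbors {v : V} (h : ∃ p < m, G.Adj v (u p)) :
    ∃ i j, i ≤ j ∧ j < m ∧ G.Adj v (u i) ∧ G.Adj v (u j) ∧ (∀ t < m, G.Adj v (u t) → i ≤ t) ∧
      ∀ t < m, G.Adj v (u t) → t ≤ j := by
  classical
  obtain ⟨p, hp, hpv⟩ := h
  let S := (Finset.range m).filter fun t => G.Adj v (u t)
  have hS : S.Nonempty := ⟨p, by simp [S, hp, hpv]⟩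
  have hi := S.min'_mem hS
  have hj := S.max'_mem hS
  simp only [S, Finset.mem_filter, Finset.mem_range] at hi hj
  exact ⟨S.min' hS, S.max' hS, S.min'_le _ (S.max'_mem hS), hj.1, hi.2, hj.2,
    fun t ht h => S.min'_le t (by simp [S, ht, h]), fun t ht h => S.le_max' t (by simp [S, ht, h])⟩

namespace LayerFn

theorem reverse (hδ : LayerFn G u m δ) : LayerFn G (fun t => u (m - 1 - t)) m δ where
  zero_iff v := by
    rw [hδ.zero_iff]
    constructor
    · rintro ⟨p, hp, rfl⟩
      exact ⟨m - 1 - p, by omega, congrArg u (by omega)⟩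
    · rintro ⟨p, hp, rfl⟩
      exact ⟨m - 1 - p, by omega, rfl⟩
  le_succ := hδ.le_succ
  exists_pred := hδ.exists_pred

theorem ne_path (hδ : LayerFn G u m δ) {v : V} (hv : δ v ≠ 0) : ∀ t < m, v ≠ u t :=
  fun t ht h => hv ((hδ.zero_iff v).2 ⟨t, ht, h⟩)

theorem not_adj_path (hδ : LayerFn G u m δ) {v : V} (hv : 2 ≤ δ v) : ∀ t < m, ¬ G.Adj v (u t) := by
  intro t ht h
  have h1 := hδ.le_succ _ _ h.symm
  have h2 := (hδ.zero_iff (u t)).2 ⟨t, ht, rfl⟩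
  omega

theorem exists_adj_path (hδ : LayerFn G u m δ) {v : V} (hv : δ v = 1) : ∃ p < m, G.Adj v (u p) := by
  obtain ⟨w, hw, hw0⟩ := hδ.exists_pred v 0 hv
  obtain ⟨p, hp, rfl⟩ := (hδ.zero_iff w).1 hw0
  exact ⟨p, hp, hw⟩

theorem exists_descent (hδ : LayerFn G u m δ) {v : V} (hv : δ v = L) :
    ∃ w : ℕ → V, w L = v ∧ (∀ k ≤ L, δ (w k) = k) ∧ ∀ k < L, G.Adj (w k) (w (k + 1)) := by
  induction L generalizing v with
  | zero =>
    refine ⟨fun _ => v, rfl, fun k hk => ?_, fun k hk => by omega⟩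
    rw [hv]; omega
  | succ L ih =>
    obtain ⟨x, hx, hxL⟩ := hδ.exists_pred v L hv
    obtain ⟨w, hwL, hw, hadj⟩ := ih hxL
    refine ⟨fun k => if k ≤ L then w k else v, by simp, fun k hk => ?_, fun k hk => ?_⟩
    · by_cases h : k ≤ L
      · simp [h, hw k h]
      · simp only [h, if_false, hv]; omega
    · by_cases h : k < L
      · simp [h.le, Nat.succ_le_of_lt h, hadj k h]
      · have : k = L := by omega
        subst this
        simp [hwL, hx.symm]

end LayerFn

section Depth

variable {w : ℕ → V}

theorem descent_inducedPath (hδ : LayerFn G u m δ) (hw : ∀ k ≤ L, δ (w k) = k)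
    (hadj : ∀ k < L, G.Adj (w k) (w (k + 1))) {j k : ℕ}
    (hj : j + k ≤ L + 1) :
    InducedPath G (fun t => w (j + t)) k where
  inj s hs t ht h := by
    have h1 := hw (j + s) (by omega)
    have h2 := hw (j + t) (by omega)
    have h3 := congrArg δ h
    omega
  adj s hs t ht := by
    have h1 := hw (j + s) (by omega)
    have h2 := hw (j + t) (by omega)
    constructor
    · intro h
      have h3 := hδ.le_succ _ _ h
      have h4 := hδ.le_succ _ _ h.symm
      have h5 : s ≠ t := by rintro rfl; exact h.ne rfl
      omega
    · rintro (rfl | rfl)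
      · exact hadj (j + s) (by omega)
      · exact (hadj (j + t) (by omega)).symm

theorem le_max_neighbor_of_longest (hδ : LayerFn G u m δ) (hP : InducedPath G u m)
    (hlong : ∀ g k, InducedPath G g k → k ≤ m) (hw : ∀ k ≤ L, δ (w k) = k)
    (hadj : ∀ k < L, G.Adj (w k) (w (k + 1))) (hL : 1 ≤ L) {j : ℕ} (hjm : j < m)
    (hj : G.Adj (w 1) (u j)) (hmax : ∀ t < m, G.Adj (w 1) (u t) → t ≤ j) : L ≤ j := by
  have key : ∀ k, 1 ≤ k → k ≤ L → ∃ g, InducedPath G g (k + (m - j)) ∧ g 0 = w k ∧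
      ∀ t < k + (m - j), 1 ≤ t → δ (g t) < k := by
    intro k hk
    induction k, hk using Nat.le_induction with
    | base =>
      intro _
      refine ⟨consSeq (w 1) fun t => u (j + t), ?_, rfl, ?_⟩
      · rw [add_comm]
        refine (hP.up (j := j) (k := m - j) (by omega)).cons hj fun t ht h1 => ?_
        refine ⟨hδ.ne_path (by rw [hw 1 hL]; omega) _ (by omega), fun h => ?_⟩
        have := hmax _ (by omega) h
        omega
      · rintro (_ | t) ht h1
        · omega
        · have : δ (u (j + t)) = 0 := (hδ.zero_iff _).2 ⟨_, by omega, rfl⟩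
          simp only [consSeq]; omega
    | succ k hk ih =>
      intro hkL
      obtain ⟨g, hg, hg0, hgδ⟩ := ih (by omega)
      have hk1 := hw (k + 1) hkL
      refine ⟨consSeq (w (k + 1)) g, ?_, rfl, ?_⟩
      · rw [Nat.add_right_comm]
        refine hg.cons (by rw [hg0]; exact (hadj k (by omega)).symm) fun t ht h1 => ?_
        have h2 := hgδ t ht h1
        refine ⟨fun h => by rw [← h] at h2; omega, fun h => ?_⟩
        have := hδ.le_succ _ _ h.symm
        omega
      · rintro (_ | t) ht h1
        · omega
        · simp only [consSeq]
          rcases Nat.eq_zero_or_pos t with rfl | h0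
          · rw [hg0, hw k (by omega)]; omega
          · have := hgδ t (by omega) h0; omega
  obtain ⟨g, hg, -, -⟩ := key L hL le_rfl
  have := hlong g _ hg
  omega

section

variable (hn : 3 ≤ n) (hF1 : ¬ HasInducedCopyG (F1G n) G) (hF2 : ¬ HasInducedCopyG (F2G n) G)
  (hstar : ¬ HasInducedCopyG (StarG n) G) (hδ : LayerFn G u m δ) (hP : InducedPath G u m)
  (hw : ∀ k ≤ L, δ (w k) = k) (hadj : ∀ k < L, G.Adj (w k) (w (k + 1)))
  (hL : 2 * n ≤ L + 1)
include hn hF1 hF2 hδ hP hw hadj hL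

theorem exists_neighbor_in_gap {i j : ℕ} (hi : i + 2 ≤ n) (hwi : G.Adj (w 1) (u i)) (hLj : L ≤ j)
    (hjm : j < m) (hwj : G.Adj (w 1) (u j)) {a : ℕ} (haj : a < j) (hwa : G.Adj (w 1) (u a)) :
    ∃ b, a < b ∧ b < a + n ∧ b ≤ j ∧ G.Adj (w 1) (u b) := by
  by_contra hgap
  push Not at hgap
  have hja : a + n ≤ j := by
    by_contra h
    exact hgap j haj (by omega) le_rfl hwj
  have hy := descent_inducedPath hδ hw hadj (k := n) (j := 2) (by omega)
  have hwu : ∀ s < n, ∀ t < m, u t ≠ w (2 + s) ∧ ¬ G.Adj (u t) (w (2 + s)) := by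
    intro s hs t ht
    have := hw (2 + s) (by omega)
    exact ⟨(hδ.ne_path (by omega) t ht).symm, fun h => hδ.not_adj_path (by omega) t ht h.symm⟩
  have hwy : ∀ t < n, G.Adj (w 1) (w (2 + t)) ↔ t = 0 := by
    intro t ht
    have h1 := hw 1 (by omega)
    have h2 := hw (2 + t) (by omega)
    refine ⟨fun h => ?_, ?_⟩
    · have := hδ.le_succ _ _ h; omega
    · rintro rfl; exact hadj 1 (by omega)
  have hz := hP.up (j := a) (k := n) (by omega)
  have hwz : ∀ t < n, G.Adj (w 1) (u (a + t)) ↔ t = 0 := by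
    intro t ht
    refine ⟨fun h => ?_, ?_⟩
    · by_contra h0
      exact hgap (a + t) (by omega) (by omega) (by omega) h
    · rintro rfl; exact hwa
  have hfork : ∀ p < m, G.Adj (w 1) (u p) → (p + 1 < a ∨ a + n < p) → False := by
    intro p hp hwp hpa
    refine not_fork hF1 hF2 hy hz hwp hwy hwz (fun t ht => hwu t ht p hp) ?_ ?_
    · intro t ht
      refine ⟨fun h => ?_, fun h => ?_⟩
      · have := hP.inj _ hp _ (by omega) h; omega
      · rw [hP.adj _ hp _ (by omega)] at h; omega
    · intro s hs t ht
      have := hwu s hs (a + t) (by omega)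
      exact ⟨this.1.symm, fun h => absurd h.symm this.2⟩
  have hj' : j = a + n := by
    by_contra h
    exact hfork j hjm hwj (by omega)
  have hi' : i + 1 = a := by
    by_contra h
    exact hfork i (by omega) hwi (by omega)
  have hz' := hP.down (i := a + n) (k := n) (by omega) (by omega)
  refine not_fork hF1 hF2 hy hz' hwi hwy ?_ (fun t ht => hwu t ht i (by omega)) ?_ ?_
  · intro t ht
    refine ⟨fun h => ?_, ?_⟩
    · by_contra h0
      exact hgap (a + n - t) (by omega) (by omega) (by omega) h
    · rintro rfl; rw [hj'] at hwj; exact hwj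
  · intro t ht
    refine ⟨fun h => ?_, fun h => ?_⟩
    · have := hP.inj _ (by omega) _ (by omega) h; omega
    · rw [hP.adj _ (by omega) _ (by omega)] at h; omega
  · intro s hs t ht
    have := hwu s hs (a + n - t) (by omega)
    exact ⟨this.1.symm, fun h => absurd h.symm this.2⟩

include hstar

theorem not_descent_near_start (hL' : n * n ≤ L + 2 * n) {i j : ℕ} (hi : i + 2 ≤ n)
    (hwi : G.Adj (w 1) (u i)) (hLj : L ≤ j) (hjm : j < m) (hwj : G.Adj (w 1) (u j)) : False := by
  classical
  have key : ∀ t, t + 2 ≤ n → ∃ J : Finset ℕ, J.card = t + 1 ∧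
      (∀ a ∈ J, a < m ∧ G.Adj (w 1) (u a)) ∧ (∀ a ∈ J, ∀ b ∈ J, a + 1 ≠ b) ∧
      ∃ c ∈ J, (∀ a ∈ J, a ≤ c) ∧ c + 2 ≤ n + t * n := by
    intro t
    induction t with
    | zero =>
      intro _
      refine ⟨{i}, by simp, ?_, ?_, i, by simp, by simp, by omega⟩
      · intro a ha
        rw [Finset.mem_singleton.1 ha]
        exact ⟨by omega, hwi⟩
      · intro a ha b hb
        rw [Finset.mem_singleton.1 ha, Finset.mem_singleton.1 hb]
        omega
    | succ t ih =>
      intro ht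
      obtain ⟨J, hJ, hJw, hJJ, c, hc, hcmax, hcn⟩ := ih (by omega)
      have hmul : t * n + 3 * n ≤ n * n := by
        rw [← Nat.add_mul]
        exact Nat.mul_le_mul_right n (by omega)
      obtain ⟨b, hcb, hbn, hbj, hwb⟩ : ∃ b, c + 1 < b ∧ b ≤ c + n ∧ b ≤ j ∧ G.Adj (w 1) (u b) := by
        obtain ⟨b, h1, h2, h3, h4⟩ := exists_neighbor_in_gap hn hF1 hF2 hδ hP hw hadj hL hi hwi hLj
          hjm hwj (a := c) (by omega) (hJw c hc).2
        by_cases hb : b = c + 1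
        · obtain ⟨b', g1, g2, g3, g4⟩ := exists_neighbor_in_gap hn hF1 hF2 hδ hP hw hadj hL hi hwi
            hLj hjm hwj (a := b) (by omega) h4
          exact ⟨b', by omega, by omega, g3, g4⟩
        · exact ⟨b, by omega, by omega, h3, h4⟩
      have hbJ : b ∉ J := fun h => by have := hcmax b h; omega
      refine ⟨insert b J, by rw [Finset.card_insert_of_notMem hbJ, hJ], ?_, ?_, b, by simp, ?_, ?_⟩
      · intro a ha
        rcases Finset.mem_insert.1 ha with rfl | ha
        · exact ⟨by omega, hwb⟩
        · exact hJw a ha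
      · intro a ha a' ha'
        rcases Finset.mem_insert.1 ha with rfl | ha <;> rcases Finset.mem_insert.1 ha' with rfl | ha'
        · omega
        · have := hcmax a' ha'; omega
        · have := hcmax a (by assumption); omega
        · exact hJJ a ha a' ha'
      · intro a ha
        rcases Finset.mem_insert.1 ha with rfl | ha
        · exact le_rfl
        · have := hcmax a ha; omega
      · rw [Nat.add_mul]; omega
  obtain ⟨J, hJ, hJw, hJJ, -⟩ := key (n - 2) (by omega)
  have h2 := hw 2 (by omega)
  have hw2 : w 2 ∉ J.image u := by
    rw [Finset.mem_image]
    rintro ⟨p, hp, h⟩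
    exact hδ.ne_path (v := w 2) (by omega) p (hJw p hp).1 h.symm
  have hcard : (insert (w 2) (J.image u)).card = n := by
    rw [Finset.card_insert_of_notMem hw2, Finset.card_image_of_injOn, hJ]
    · omega
    · intro p hp q hq h
      exact hP.inj p (hJw p hp).1 q (hJw q hq).1 h
  have := card_lt_of_star_free hstar (w 1) (insert (w 2) (J.image u)) ?_ ?_
  · omega
  · intro x hx
    rcases Finset.mem_insert.1 hx with rfl | hx
    · exact hadj 1 (by omega)
    · obtain ⟨p, hp, rfl⟩ := Finset.mem_image.1 hx
      exact (hJw p hp).2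
  · intro x hx y hy h
    rcases Finset.mem_insert.1 hx with rfl | hx <;> rcases Finset.mem_insert.1 hy with rfl | hy
    · exact h.ne rfl
    · obtain ⟨p, hp, rfl⟩ := Finset.mem_image.1 hy
      exact hδ.not_adj_path (v := w 2) (by omega) p (hJw p hp).1 h
    · obtain ⟨p, hp, rfl⟩ := Finset.mem_image.1 hx
      exact hδ.not_adj_path (v := w 2) (by omega) p (hJw p hp).1 h.symm
    · obtain ⟨p, hp, rfl⟩ := Finset.mem_image.1 hx
      obtain ⟨q, hq, rfl⟩ := Finset.mem_image.1 hy
      rw [hP.adj p (hJw p hp).1 q (hJw q hq).1] at h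
      rcases h with h | h
      · exact hJJ p hp q hq h
      · exact hJJ q hq p hp h

end

/-- The layers around a longest induced path never reach level `L`. -/
theorem layer_ne (hn : 3 ≤ n) (hF1 : ¬ HasInducedCopyG (F1G n) G)
    (hF2 : ¬ HasInducedCopyG (F2G n) G) (hstar : ¬ HasInducedCopyG (StarG n) G)
    (hδ : LayerFn G u m δ) (hP : InducedPath G u m) (hlong : ∀ g k, InducedPath G g k → k ≤ m)
    (hL : 2 * n ≤ L + 1) (hL' : n * n ≤ L + 2 * n) (v : V) : δ v ≠ L := by
  intro hv
  obtain ⟨w, -, hw, hadj⟩ := hδ.exists_descent hv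
  have hw1 := hw 1 (by omega)
  have hw2 := hw 2 (by omega)
  obtain ⟨i, j, hij, hjm, hwi, hwj, hmin, hmax⟩ := exists_extreme_neighbors (hδ.exists_adj_path hw1)
  have hLj := le_max_neighbor_of_longest hδ hP hlong hw hadj (by omega) hjm hwj hmax
  have hsub : ∀ t < m, m - 1 - (m - 1 - t) = t := fun t ht => by omega
  have hmax' : ∀ t < m, G.Adj (w 1) (u (m - 1 - t)) → t ≤ m - 1 - i := by
    intro t ht h
    have := hmin _ (by omega) h; omega
  have hLi := le_max_neighbor_of_longest hδ.reverse hP.reverse hlong hw hadj (by omega)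
    (j := m - 1 - i) (by omega) (by rw [hsub i (by omega)]; exact hwi) hmax'
  have hv1 := hδ.ne_path (v := w 1) (by omega)
  rcases hij.eq_or_lt with rfl | hlt
  · refine not_unique_neighbor hF1 hF2 hP hv1 (i := i) (by omega) (by omega) fun t ht =>
      ⟨fun h => ?_, ?_⟩
    · have := hmin t ht h; have := hmax t ht h; omega
    · rintro rfl; exact hwi
  · by_cases hi : i + 2 ≤ n
    · exact not_descent_near_start hn hF1 hF2 hstar hδ hP hw hadj hL hL' hi hwi hLj hjm hwj
    by_cases hj : j + n ≤ m
    · refine not_outer_neighbor hF1 hF2 hP (by omega) hlt hj hwi hwj hmin hmax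
        (x := w 2) (hadj 1 (by omega)) fun t ht _ =>
          ⟨hδ.ne_path (by omega) t ht, hδ.not_adj_path (by omega) t ht⟩
    · refine not_descent_near_start hn hF1 hF2 hstar hδ.reverse hP.reverse hw hadj hL hL'
        (i := m - 1 - j) (by omega) ?_ hLi (by omega) ?_
      · rw [hsub j hjm]; exact hwj
      · rw [hsub i (by omega)]; exact hwi

end Depth

section FirstLayer

/-- The vertices next to a long induced path that have a neighbor further away are attached to the
ends of the path. -/
theorem exists_end_neighbor (hF1 : ¬ HasInducedCopyG (F1G n) G)
    (hF2 : ¬ HasInducedCopyG (F2G n) G) (hδ : LayerFn G u m δ) (hP : InducedPath G u m) {v x : V}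
    (hv : δ v = 1) (hx : δ x = 2) (hvx : G.Adj v x) :
    ∃ p < m, (p < n ∨ m ≤ p + n) ∧ G.Adj v (u p) := by
  obtain ⟨i, j, hij, hjm, hvi, hvj, hmin, hmax⟩ := exists_extreme_neighbors (hδ.exists_adj_path hv)
  have hvP := hδ.ne_path (v := v) (by omega)
  by_cases hi : i < n
  · exact ⟨i, by omega, Or.inl hi, hvi⟩
  by_cases hj : m ≤ j + n
  · exact ⟨j, by omega, Or.inr hj, hvj⟩
  exfalso
  have hspan := neighbors_span hF1 hF2 hP hvP (i := i) (j := j) (by omega) (by omega) hvi hvj hmin hmax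
  refine not_outer_neighbor hF1 hF2 hP (by omega) hspan.1 (by omega) hvi hvj hmin hmax hvx
    fun t ht _ => ⟨hδ.ne_path (by omega) t ht, hδ.not_adj_path (by omega) t ht⟩

end FirstLayer

end Layers

section Runs

variable {V : Type} {E : V → V → Prop} {u : ℕ → V} {lo hi d : ℕ}

/-- A directed path along the arcs `u p → u (p + 1)` with detours `u p → b p → u (p + d)` at all
positions `p` congruent to `r` modulo `d`. -/
theorem exists_path_with_detours (hd : 0 < d) (r : ℕ)
    (hup : ∀ p, lo ≤ p → p < hi → E (u p) (u (p + 1)))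
    (hinj : ∀ p q, lo ≤ p → p < q → q ≤ hi → u p ≠ u q) (b : ℕ → List V)
    (hnd : ∀ p, (b p).Nodup) (hch : ∀ p, (b p).IsChain E) (hoff : ∀ p, ∀ v ∈ b p, ∀ q, lo ≤ q → q ≤ hi → v ≠ u q)
    (hdisj : ∀ p q, p ≠ q → ∀ v ∈ b p, v ∉ b q)
    (hin : ∀ p, lo ≤ p → p + d ≤ hi → ∀ v ∈ b p, E (u p) v)
    (hout : ∀ p, lo ≤ p → p + d ≤ hi → ∀ v ∈ b p, E v (u (p + d))) (p : ℕ) (hlo : lo ≤ p) (hhi : p ≤ hi) :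
    ∃ l : List V, (u p :: l).Nodup ∧ (u p :: l).IsChain E ∧
      (∀ x ∈ u p :: l, ∃ q, p ≤ q ∧ (q ≤ hi ∧ x = u q ∨ x ∈ b q)) ∧
      ∀ q, p ≤ q → q % d = r → (q ≤ hi → u q ∈ u p :: l) ∧ (q + d ≤ hi → ∀ x ∈ b q, x ∈ u p :: l) := by
  induction hk : hi - p using Nat.strong_induction_on generalizing p with
  | _ k ih =>
    have hnew : ∀ q, p < q → ∀ l : List V,
        (∀ x ∈ l, ∃ q', q ≤ q' ∧ (q' ≤ hi ∧ x = u q' ∨ x ∈ b q')) → u p ∉ l := by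
      intro q hq l hl hmem
      obtain ⟨q', hq', ⟨h1, h2⟩ | h2⟩ := hl _ hmem
      · exact hinj p q' hlo (by omega) h1 h2
      · exact hoff _ _ h2 p hlo hhi rfl
    by_cases hdet : p % d = r ∧ p + d ≤ hi ∧ b p ≠ []
    · obtain ⟨hpr, hpd, hb⟩ := hdet
      obtain ⟨l, h1, h2, h3, h4⟩ := ih (hi - (p + d)) (by omega) (p + d) (by omega) hpd rfl
      have hbl : ∀ x ∈ b p, x ∉ u (p + d) :: l := by
        intro x hx hxl
        obtain ⟨q, hq, ⟨g1, g2⟩ | g2⟩ := h3 x hxl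
        · exact hoff p x hx q (by omega) g1 g2
        · exact hdisj p q (by omega) x hx g2
      have hupb : u p ∉ b p := fun h => hoff p _ h p hlo hhi rfl
      refine ⟨b p ++ u (p + d) :: l, ?_, ?_, ?_, ?_⟩
      · rw [List.nodup_cons, List.mem_append, List.nodup_append]
        refine ⟨?_, hnd p, h1, fun x hx y hy hxy => hbl x hx (hxy ▸ hy)⟩
        rintro (h | h)
        · exact hupb h
        · exact hnew (p + d) (by omega) _ h3 h
      · rw [← List.cons_append, List.isChain_append]
        refine ⟨?_, h2, ?_⟩
        · rw [List.isChain_cons]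
          exact ⟨fun y hy => hin p hlo hpd y (List.mem_of_mem_head? hy), hch p⟩
        · intro x hx y hy
          simp only [List.head?_cons, Option.mem_some_iff] at hy
          subst hy
          rw [List.getLast?_cons] at hx
          refine hout p hlo hpd x ?_
          cases hl : (b p).getLast? with
          | none => exact absurd (List.getLast?_eq_none_iff.1 hl) hb
          | some z =>
            rw [hl] at hx
            simp only [Option.getD_some, Option.mem_some_iff] at hx
            subst hx
            exact List.mem_of_getLast? hl
      · intro x hx
        rcases List.mem_cons.1 hx with rfl | hx
        · exact ⟨p, le_rfl, Or.inl ⟨hhi, rfl⟩⟩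
        rcases List.mem_append.1 hx with hx | hx
        · exact ⟨p, le_rfl, Or.inr hx⟩
        · obtain ⟨q, hq, h⟩ := h3 x hx
          exact ⟨q, by omega, h⟩
      · intro q hq hqr
        rcases hq.eq_or_lt with rfl | hlt
        · exact ⟨fun _ => by simp, fun _ x hx => by simp [hx]⟩
        · have hqd : p + d ≤ q := by
            by_contra hcon
            have h5 : (q - p) % d = 0 := by
              have : q ≡ p [MOD d] := hqr.trans hpr.symm
              exact (Nat.modEq_iff_dvd' hq).1 this.symm |> Nat.mod_eq_zero_of_dvd
            rw [Nat.mod_eq_of_lt (by omega)] at h5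
            omega
          have := h4 q hqd hqr
          exact ⟨fun h => List.mem_cons_of_mem _ (List.mem_append_right _ (this.1 h)),
            fun h x hx => List.mem_cons_of_mem _ (List.mem_append_right _ (this.2 h x hx))⟩
    · have hbp : p % d = r → p + d ≤ hi → b p = [] := fun g1 g2 => by
        by_contra g3
        exact hdet ⟨g1, g2, g3⟩
      rcases hhi.eq_or_lt with rfl | hlt
      · refine ⟨[], by simp, by simp, fun x hx => ⟨p, le_rfl, Or.inl ⟨le_rfl, by simpa using hx⟩⟩,
          fun q hq _ => ⟨fun h => ?_, fun h => by omega⟩⟩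
        simp [show q = p by omega]
      · obtain ⟨l, h1, h2, h3, h4⟩ := ih (hi - (p + 1)) (by omega) (p + 1) (by omega) hlt rfl
        refine ⟨u (p + 1) :: l, ?_, ?_, ?_, ?_⟩
        · exact List.nodup_cons.2 ⟨hnew (p + 1) (by omega) _ h3, h1⟩
        · exact List.isChain_cons_cons.2 ⟨hup p hlo hlt, h2⟩
        · intro x hx
          rcases List.mem_cons.1 hx with rfl | hx
          · exact ⟨p, le_rfl, Or.inl ⟨hhi, rfl⟩⟩
          · obtain ⟨q, hq, h⟩ := h3 x hx
            exact ⟨q, by omega, h⟩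
        · intro q hq hqr
          rcases hq.eq_or_lt with rfl | hlt'
          · exact ⟨fun _ => by simp, fun h x hx => by simp [hbp hqr h] at hx⟩
          · have := h4 q hlt' hqr
            exact ⟨fun h => List.mem_cons_of_mem _ (this.1 h),
              fun h x hx => List.mem_cons_of_mem _ (this.2 h x hx)⟩

section

variable (hup : ∀ p, lo ≤ p → p < hi → E (u p) (u (p + 1)))
  (hinj : ∀ p q, lo ≤ p → p < q → q ≤ hi → u p ≠ u q)
include hup hinj

theorem run_pathCoverable : PathCoverable E {x | ∃ p, lo ≤ p ∧ p ≤ hi ∧ x = u p} 1 := by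
  by_cases h : lo ≤ hi
  · obtain ⟨l, h1, h2, -, h4⟩ := exists_path_with_detours (d := 1) one_pos 0 hup hinj (fun _ => [])
      (by simp) (by simp) (by simp) (by simp) (by simp) (by simp) lo le_rfl h
    refine ⟨[u lo :: l], by simp, by simpa using ⟨List.nodup_cons.1 h1, h2⟩, ?_⟩
    rintro x ⟨p, hp, hp', rfl⟩
    exact ⟨_, by simp, (h4 p hp (Nat.mod_one p)).1 hp'⟩
  · exact ⟨[], by simp, by simp, by rintro x ⟨p, hp, hp', rfl⟩; omega⟩

theorem detours_pathCoverable [Finite V] (hirr : ∀ v, ¬ E v v) (hd : 0 < d) (B : ℕ → Set V) (k : ℕ)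
    (hB : ∀ p, IndepBound E (B p) k) (hoff : ∀ p, ∀ v ∈ B p, ∀ q, lo ≤ q → q ≤ hi → v ≠ u q)
    (hdisj : ∀ p q, p ≠ q → ∀ v ∈ B p, v ∉ B q) (hin : ∀ p, ∀ v ∈ B p, E (u p) v)
    (hout : ∀ p, ∀ v ∈ B p, E v (u (p + d))) :
    PathCoverable E {v | ∃ p, lo ≤ p ∧ p + d ≤ hi ∧ v ∈ B p} (d * k) := by
  by_cases hlh : lo ≤ hi
  swap
  · exact ⟨[], by simp, by simp, by rintro x ⟨p, hp, hp', -⟩; omega⟩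
  choose F hF1 hF2 hF3 using fun p => exists_paths_of_indepBound hirr (hB p)
  let b : ℕ → ℕ → List V := fun c p => ((F p)[c]?).getD []
  have hb : ∀ c p, b c p = [] ∨ b c p ∈ F p := by
    intro c p
    by_cases hc : c < (F p).length
    · right; simp [b, hc]
    · left; simp [b, not_lt.1 hc]
  have hbB : ∀ c p, ∀ v ∈ b c p, v ∈ B p := by
    intro c p v hv
    rcases hb c p with h | h
    · simp [h] at hv
    · exact (hF2 p _ h).2.2 v hv
  have key : ∀ x ∈ Finset.range d ×ˢ Finset.range k,
      PathCoverable E {v | ∃ p, lo ≤ p ∧ p + d ≤ hi ∧ p % d = x.1 ∧ v ∈ b x.2 p} 1 := by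
    intro x _
    obtain ⟨l, h1, h2, -, h4⟩ := exists_path_with_detours hd x.1 hup hinj (b x.2)
      (fun p => by
        rcases hb x.2 p with h | h
        · simp [h]
        · exact (hF2 p _ h).1)
      (fun p => by
        rcases hb x.2 p with h | h
        · simp [h]
        · exact (hF2 p _ h).2.1)
      (fun p v hv => hoff p v (hbB _ p v hv))
      (fun p q hpq v hv hv' => hdisj p q hpq v (hbB _ p v hv) (hbB _ q v hv'))
      (fun p _ _ v hv => hin p v (hbB _ p v hv)) (fun p _ _ v hv => hout p v (hbB _ p v hv))
      lo le_rfl hlh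
    refine ⟨[u lo :: l], by simp, by simpa using ⟨List.nodup_cons.1 h1, h2⟩, ?_⟩
    rintro v ⟨p, hp, hp', hpr, hv⟩
    exact ⟨_, by simp, (h4 p hp hpr).2 hp' v hv⟩
  refine (PathCoverable.biUnion _ key).mono ?_ (by simp)
  rintro v ⟨p, hp, hp', hv⟩
  obtain ⟨l, hl, hvl⟩ := hF3 p v hv
  obtain ⟨c, hc, rfl⟩ := List.mem_iff_getElem.1 hl
  simp only [Set.mem_iUnion]
  refine ⟨(p % d, c), ?_, p, hp, hp', rfl, ?_⟩
  · simp [Nat.mod_lt p hd, hc.trans_le (hF1 p)]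
  · simpa [b, hc] using hvl

end

/-- In the path `a, b, c` the vertex `b` has in-degree or out-degree two. -/
def Turn (E : V → V → Prop) (a b c : V) : Prop := (E b a ∧ E b c) ∨ (E a b ∧ E c b)

theorem run_oriented (hadj : ∀ p, lo ≤ p → p < hi → E (u p) (u (p + 1)) ∨ E (u (p + 1)) (u p))
    (hturn : ∀ p, lo ≤ p → p + 1 < hi → ¬ Turn E (u p) (u (p + 1)) (u (p + 1 + 1))) :
    (∀ p, lo ≤ p → p < hi → E (u p) (u (p + 1))) ∨
      ∀ p, lo ≤ p → p < hi → E (u (p + 1)) (u p) := by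
  rcases Nat.lt_or_ge lo hi with h | h
  · rcases hadj lo le_rfl h with h0 | h0
    · left
      intro p hp
      induction p, hp using Nat.le_induction with
      | base => exact fun _ => h0
      | succ p hp ih =>
        intro hlt
        rcases hadj (p + 1) (by omega) hlt with g | g
        · exact g
        · exact absurd (Or.inr ⟨ih (by omega), g⟩) (hturn p hp hlt)
    · right
      intro p hp
      induction p, hp using Nat.le_induction with
      | base => exact fun _ => h0
      | succ p hp ih =>
        intro hlt
        rcases hadj (p + 1) (by omega) hlt with g | g
        · exact absurd (Or.inl ⟨ih (by omega), g⟩) (hturn p hp hlt)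
        · exact g
  · exact Or.inl fun p hp hp' => by omega

end Runs

section Triangles

variable {V : Type} {E : V → V → Prop} {u : ℕ → V} {n m : ℕ}

theorem triangle_oriented (hD : CondD2 n E) (hE : ∀ u v : V, E u v → ¬ E v u)
    (hP : InducedPath (SimpleGraph.fromRel E) u m) {v : V} (hv : ∀ t < m, v ≠ u t) {i : ℕ}
    (hi : n ≤ i + 1) (him : i + n < m) (hvi : (SimpleGraph.fromRel E).Adj v (u i))
    (hvj : (SimpleGraph.fromRel E).Adj v (u (i + 1)))
    (hmin : ∀ t < m, (SimpleGraph.fromRel E).Adj v (u t) → i ≤ t)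
    (hmax : ∀ t < m, (SimpleGraph.fromRel E).Adj v (u t) → t ≤ i + 1)
    (hup : ∀ p, i + 1 ≤ p + n → p < i + n → E (u p) (u (p + 1))) :
    E (u i) v ∧ E v (u (i + 1)) := by
  simp only [adj_fromRel_iff hE] at hvi hvj hmin hmax
  have hPE : ∀ s < m, ∀ t < m, E (u s) (u t) → s + 1 = t ∨ t + 1 = s := fun s hs t ht h =>
    (hP.adj s hs t ht).1 ((adj_fromRel_iff hE _ _).2 (Or.inl h))
  have hst : ∀ s < m, ∀ t < m, i + 1 ≤ s + n → i + 1 ≤ t + n → s ≤ i + n → t ≤ i + n →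
      (E (u s) (u t) ↔ s + 1 = t) := by
    intro s hs t ht h1 h2 h3 h4
    constructor
    · intro h
      rcases hPE s hs t ht h with h5 | h5
      · exact h5
      · subst h5
        exact absurd h (hE _ _ (hup t h2 (by omega)))
    · rintro rfl
      exact hup s h1 (by omega)
  let f : Unit ⊕ Fin n ⊕ Fin n → V :=
    Sum.elim (fun _ => v) (Sum.elim (fun t => u (i - t)) fun t => u (i + 1 + t))
  have hinj : Function.Injective f := by
    rintro (s | s | s) (t | t | t) h
    · rfl
    · exact absurd h (hv _ (by omega))
    · exact absurd h (hv _ (by omega))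
    · exact absurd h.symm (hv _ (by omega))
    · have := hP.inj _ (by omega) _ (by omega) h
      exact congrArg _ (congrArg _ (Fin.ext (by omega)))
    · have := hP.inj _ (by omega) _ (by omega) h; omega
    · exact absurd h.symm (hv _ (by omega))
    · have := hP.inj _ (by omega) _ (by omega) h; omega
    · have := hP.inj _ (by omega) _ (by omega) h
      exact congrArg _ (congrArg _ (Fin.ext (by omega)))
  have hxx : ¬ E v v := fun h => hE _ _ h h
  have hxy : ∀ t : Fin n, E v (u (i - t)) ↔ t.val = 0 ∧ E v (u i) := by
    intro t
    refine ⟨fun h => ?_, fun ⟨h, h'⟩ => by rw [h]; exact h'⟩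
    have h1 := hmin _ (by omega) (Or.inl h)
    have h2 : t.val = 0 := by omega
    rw [h2] at h
    exact ⟨h2, h⟩
  have hyx : ∀ t : Fin n, E (u (i - t)) v ↔ t.val = 0 ∧ E (u i) v := by
    intro t
    refine ⟨fun h => ?_, fun ⟨h, h'⟩ => by rw [h]; exact h'⟩
    have h1 := hmin _ (by omega) (Or.inr h)
    have h2 : t.val = 0 := by omega
    rw [h2] at h
    exact ⟨h2, h⟩
  have hxz : ∀ t : Fin n, E v (u (i + 1 + t)) ↔ t.val = 0 ∧ E v (u (i + 1)) := by
    intro t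
    refine ⟨fun h => ?_, fun ⟨h, h'⟩ => by rw [h]; exact h'⟩
    have h1 := hmax _ (by omega) (Or.inl h)
    have h2 : t.val = 0 := by omega
    rw [h2] at h
    exact ⟨h2, h⟩
  have hzx : ∀ t : Fin n, E (u (i + 1 + t)) v ↔ t.val = 0 ∧ E (u (i + 1)) v := by
    intro t
    refine ⟨fun h => ?_, fun ⟨h, h'⟩ => by rw [h]; exact h'⟩
    have h1 := hmax _ (by omega) (Or.inr h)
    have h2 : t.val = 0 := by omega
    rw [h2] at h
    exact ⟨h2, h⟩
  have hyy : ∀ s t : Fin n, E (u (i - s)) (u (i - t)) ↔ t.val + 1 = s.val := fun s t => by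
    rw [hst _ (by omega) _ (by omega) (by omega) (by omega) (by omega) (by omega)]; omega
  have hzz : ∀ s t : Fin n, E (u (i + 1 + s)) (u (i + 1 + t)) ↔ s.val + 1 = t.val := fun s t => by
    rw [hst _ (by omega) _ (by omega) (by omega) (by omega) (by omega) (by omega)]; omega
  have hyz : ∀ s t : Fin n, E (u (i - s)) (u (i + 1 + t)) ↔ s.val = 0 ∧ t.val = 0 := fun s t => by
    rw [hst _ (by omega) _ (by omega) (by omega) (by omega) (by omega) (by omega)]; omega
  have hzy : ∀ s t : Fin n, ¬ E (u (i + 1 + s)) (u (i - t)) := fun s t => by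
    rw [hst _ (by omega) _ (by omega) (by omega) (by omega) (by omega) (by omega)]; omega
  have hcases : (E (u i) v ∧ E v (u (i + 1))) ∨ (E v (u i) ∧ E (u (i + 1)) v) ∨
      (E v (u i) ∧ E v (u (i + 1))) ∨ (E (u i) v ∧ E (u (i + 1)) v) := by tauto
  rcases hcases with h | ⟨h, h'⟩ | ⟨h, h'⟩ | ⟨h, h'⟩
  · exact h
  · refine absurd ⟨f, hinj, ?_⟩ hD.1
    rintro (s | s | s) (t | t | t) <;>
      simp [f, D1Rel, hxx, hxy, hyx, hxz, hzx, hyy, hzz, hyz, hzy, h, h', hE _ _ h, hE _ _ h']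
  · refine absurd ⟨f, hinj, ?_⟩ hD.2.1
    rintro (s | s | s) (t | t | t) <;>
      simp [f, D2Rel, hxx, hxy, hyx, hxz, hzx, hyy, hzz, hyz, hzy, h, h', hE _ _ h, hE _ _ h']
  · refine absurd ⟨f, hinj, ?_⟩ hD.2.2
    rintro (s | s | s) (t | t | t) <;>
      simp [f, D3Rel, hxx, hxy, hyx, hxz, hzx, hyy, hzz, hyz, hzy, h, h', hE _ _ h, hE _ _ h']

theorem triangle_oriented_down (hn : 0 < n) (hD : CondD2 n E) (hE : ∀ u v : V, E u v → ¬ E v u)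
    (hP : InducedPath (SimpleGraph.fromRel E) u m) {v : V} (hv : ∀ t < m, v ≠ u t) {i : ℕ}
    (hi : n ≤ i + 1) (him : i + n < m) (hvi : (SimpleGraph.fromRel E).Adj v (u i))
    (hvj : (SimpleGraph.fromRel E).Adj v (u (i + 1)))
    (hmin : ∀ t < m, (SimpleGraph.fromRel E).Adj v (u t) → i ≤ t)
    (hmax : ∀ t < m, (SimpleGraph.fromRel E).Adj v (u t) → t ≤ i + 1)
    (hdown : ∀ p, i + 1 ≤ p + n → p < i + n → E (u (p + 1)) (u p)) :
    E (u (i + 1)) v ∧ E v (u i) := by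
  have h1 : m - 1 - (m - 1 - (i + 1)) = i + 1 := by omega
  have h2 : m - 1 - (m - 1 - (i + 1) + 1) = i := by omega
  have := triangle_oriented hD hE hP.reverse (v := v) (i := m - 1 - (i + 1))
    (fun t ht => hv _ (by omega)) (by omega) (by omega) (by rwa [h1]) (by rwa [h2])
    (fun t ht h => by have := hmax _ (by omega) h; omega)
    (fun t ht h => by have := hmin _ (by omega) h; omega)
    (fun p hp hp' => by
      have := hdown (m - 1 - (p + 1)) (by omega) (by omega)
      rwa [show m - 1 - (p + 1) + 1 = m - 1 - p by omega] at this)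
  rwa [h1, h2] at this

end Triangles

section Turns

variable {V : Type} {E : V → V → Prop} {u : ℕ → V} {n m : ℕ}

theorem card_turns_le (h3 : CondD3 n E) (hE : ∀ u v : V, E u v → ¬ E v u) {g : ℕ → V} {k : ℕ}
    (hg : InducedPath (SimpleGraph.fromRel E) g k) (S : Finset ℕ)
    (hS : ∀ t ∈ S, t + 2 < k ∧ Turn E (g t) (g (t + 1)) (g (t + 2))) : S.card ≤ n := by
  classical
  refine le_trans ?_ (h3 k (fun i => g i) ⟨fun i j h => Fin.ext (hg.inj i i.2 j j.2 h), fun i j => ?_⟩)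
  · rw [turnCount, ← Set.ncard_coe_finset S, ← Set.ncard_image_of_injective _ Fin.val_injective]
    rw [← Set.ncard_image_of_injective (S : Set ℕ) (add_left_injective 1)]
    refine Set.ncard_le_ncard ?_ (Set.toFinite _)
    rintro _ ⟨t, ht, rfl⟩
    obtain ⟨h1, h2⟩ := hS t ht
    exact ⟨⟨t + 1, by omega⟩, ⟨⟨t, by omega⟩, ⟨t + 2, h1⟩, rfl, rfl, h2⟩, rfl⟩
  · rw [← adj_fromRel_iff hE]
    exact hg.adj i i.2 j j.2

/-- `v` lies off the path `u 0, …, u (m - 1)`, and `u i` and `u j` are its first and its last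
neighbor on this path. -/
structure Attached (G : SimpleGraph V) (u : ℕ → V) (m : ℕ) (v : V) (i j : ℕ) : Prop where
  ne : ∀ t < m, v ≠ u t
  lt : j < m
  adj_min : G.Adj v (u i)
  adj_max : G.Adj v (u j)
  min : ∀ t < m, G.Adj v (u t) → i ≤ t
  max : ∀ t < m, G.Adj v (u t) → t ≤ j

theorem Attached.unique {G : SimpleGraph V} {v : V} {i j i' j' : ℕ} (h : Attached G u m v i j)
    (h' : Attached G u m v i' j') : i = i' := by
  have h1 := h.min i' ((h'.min j' h'.lt h'.adj_max).trans_lt h'.lt) h'.adj_min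
  have h2 := h'.min i ((h.min j h.lt h.adj_max).trans_lt h.lt) h.adj_min
  omega

/-- The vertex `v` replaces the part of the path strictly between `u c` and `u j`, creating a turn
at `u c` or at `v`. -/
def TurningDetour (E : V → V → Prop) (u : ℕ → V) (n m c : ℕ) (v : V) (j : ℕ) : Prop :=
  Attached (SimpleGraph.fromRel E) u m v c j ∧ c + 2 ≤ j ∧ j + n < m ∧
    (Turn E (u (c - 1)) (u c) v ∨ Turn E (u c) v (u j))

/-- The path turns at `u c`, or there is a turning detour at `u c`. -/
def BadPos (E : V → V → Prop) (u : ℕ → V) (n m c : ℕ) : Prop :=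
  n ≤ c ∧ c + n < m ∧ (Turn E (u (c - 1)) (u c) (u (c + 1)) ∨ ∃ v j, TurningDetour E u n m c v j)

theorem card_spaced_badPos_le (hn : 2 ≤ n) (hF1 : ¬ HasInducedCopyG (F1G n) (SimpleGraph.fromRel E))
    (hF2 : ¬ HasInducedCopyG (F2G n) (SimpleGraph.fromRel E)) (h3 : CondD3 n E)
    (hE : ∀ u v : V, E u v → ¬ E v u) (hP : InducedPath (SimpleGraph.fromRel E) u m) (C : Finset ℕ)
    (hC : ∀ c ∈ C, BadPos E u n m c) (hsp : ∀ c ∈ C, ∀ c' ∈ C, c < c' → c + (n + 3) ≤ c') :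
    C.card ≤ n := by
  classical
  by_cases hm : m < 2
  · rw [Finset.eq_empty_of_forall_notMem (s := C) fun c hc => by have := (hC c hc).2.1; omega]
    simp
  let D : ℕ → Prop := fun c => ∃ v j, TurningDetour E u n m c v j
  have hD : ∀ c, ∃ v j, D c → TurningDetour E u n m c v j := by
    intro c
    by_cases h : D c
    · obtain ⟨v, j, h⟩ := h
      exact ⟨v, j, fun _ => h⟩
    · exact ⟨u 0, 0, fun h' => absurd h' h⟩
  choose x J hx using hD
  let Mem : ℕ → V → Prop := fun p y =>
    (∃ q, p < q ∧ q < m ∧ y = u q) ∨ ∃ c ∈ C, p < c ∧ D c ∧ y = x c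
  have hmono : ∀ p q y, p ≤ q → Mem q y → Mem p y := by
    rintro p q y hpq (⟨r, h1, h2, rfl⟩ | ⟨c, hc, h1, h2, rfl⟩)
    · exact Or.inl ⟨r, by omega, h2, rfl⟩
    · exact Or.inr ⟨c, hc, by omega, h2, rfl⟩
  have hu : ∀ p q y, p < q → q < m → Mem q y →
      u p ≠ y ∧ ¬ (SimpleGraph.fromRel E).Adj (u p) y := by
    rintro p q y hpq hq (⟨r, h1, h2, rfl⟩ | ⟨c, hc, h1, h2, rfl⟩)
    · refine ⟨fun h => ?_, fun h => ?_⟩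
      · have := hP.inj _ (by omega) _ h2 h; omega
      · rw [hP.adj _ (by omega) _ h2] at h; omega
    · have hA := (hx c h2).1
      refine ⟨(hA.ne p (by omega)).symm, fun h => ?_⟩
      have := hA.min p (by omega) h.symm; omega
  have hxm : ∀ c ∈ C, D c → ∀ y, Mem (J c) y →
      x c ≠ y ∧ ¬ (SimpleGraph.fromRel E).Adj (x c) y := by
    intro c hc hDc y hy
    obtain ⟨hA, h2, hJm, -⟩ := hx c hDc
    rcases hy with ⟨r, g1, g2, rfl⟩ | ⟨c', hc', g1, g2, rfl⟩
    · refine ⟨hA.ne r g2, fun h => ?_⟩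
      have := hA.max r g2 h; omega
    · have hA' := (hx c' g2).1
      refine ⟨fun h => ?_, fun h => ?_⟩
      · rw [h] at hA
        have := hA.unique hA'; omega
      · have hb := hC c hc
        have hs := hsp c hc c' hc' (by omega)
        have hspan := neighbors_span hF1 hF2 hP hA.ne hb.1 hJm hA.adj_min hA.adj_max hA.min hA.max
        refine not_outer_neighbor hF1 hF2 hP (by have := hb.1; omega) hspan.1 hJm.le
          hA.adj_min hA.adj_max hA.min hA.max h fun t ht htt => ⟨hA'.ne t ht, fun h' => ?_⟩
        have := hA'.min t ht h'; omega
  have hadj : ∀ p, p + 1 < m → (SimpleGraph.fromRel E).Adj (u p) (u (p + 1)) := fun p hp =>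
    (hP.adj _ (by omega) _ hp).2 (Or.inl rfl)
  have key : ∀ p, p + 2 ≤ m → ∃ g k, InducedPath (SimpleGraph.fromRel E) g k ∧ 2 ≤ k ∧ g 0 = u p ∧
      g 1 = u (p + 1) ∧ (∀ t < k, 1 ≤ t → Mem p (g t)) ∧ ∃ S : Finset ℕ,
        (C.filter (p < ·)).card ≤ S.card ∧
          ∀ t ∈ S, t + 2 < k ∧ Turn E (g t) (g (t + 1)) (g (t + 2)) := by
    intro p hp
    induction hk : m - p using Nat.strong_induction_on generalizing p with
    | _ N ih =>
    rcases hp.eq_or_lt with hp' | hlt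
    · refine ⟨fun t => u (p + t), 2, hP.up (by omega), le_rfl, rfl, rfl, ?_, ∅, ?_, by simp⟩
      · intro t ht h1
        exact Or.inl ⟨p + t, by omega, by omega, rfl⟩
      · rw [Finset.filter_eq_empty_iff.2]
        intro c hc
        have := (hC c hc).2.1; omega
    · by_cases hcase : p + 1 ∈ C ∧ ¬ Turn E (u p) (u (p + 1)) (u (p + 1 + 1))
      · obtain ⟨hpC, hnt⟩ := hcase
        have hb := hC _ hpC
        have hDp : D (p + 1) := by
          rcases hb.2.2 with h | h
          · exact absurd h hnt
          · exact h
        obtain ⟨hA, h2, hJm, hturn⟩ := hx _ hDp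
        set v := x (p + 1) with hv
        set j := J (p + 1) with hj
        have hspan := neighbors_span hF1 hF2 hP hA.ne hb.1 hJm hA.adj_min hA.adj_max hA.min hA.max
        obtain ⟨g, k, hg, hk2, hg0, hg1, hgm, S, hSc, hS⟩ := ih (m - j) (by omega) j (by omega) rfl
        have hgv : InducedPath (SimpleGraph.fromRel E) (consSeq v g) (k + 1) :=
          hg.cons (by rw [hg0]; exact hA.adj_max) fun t ht h1 => hxm _ hpC hDp _ (hgm t ht h1)
        have hgj : ∀ t < k, (1 ≤ t → Mem j (g t)) ∧ Mem (p + 2) (g t) := by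
          intro t ht
          refine ⟨hgm t ht, ?_⟩
          rcases Nat.eq_zero_or_pos t with rfl | h1
          · rw [hg0]; exact Or.inl ⟨j, by omega, hA.lt, rfl⟩
          · exact hmono _ _ _ (by omega) (hgm t ht h1)
        have hgc : InducedPath (SimpleGraph.fromRel E) (consSeq (u (p + 1)) (consSeq v g)) (k + 2) := by
          refine hgv.cons hA.adj_min.symm ?_
          rintro (_ | t) ht h1
          · omega
          · exact hu _ (p + 2) _ (by omega) (by omega) (hgj t (by omega)).2
        have hvm : Mem p v := Or.inr ⟨p + 1, hpC, by omega, hDp, rfl⟩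
        have hgp : InducedPath (SimpleGraph.fromRel E)
            (consSeq (u p) (consSeq (u (p + 1)) (consSeq v g))) (k + 3) := by
          refine hgc.cons (hadj p (by omega)) ?_
          rintro (_ | _ | t) ht h1
          · omega
          · refine ⟨(hA.ne p (by omega)).symm, fun h => ?_⟩
            have := hA.min p (by omega) h.symm; omega
          · exact hu _ (p + 2) _ (by omega) (by omega) (hgj t (by omega)).2
        refine ⟨_, _, hgp, by omega, rfl, rfl, ?_, ?_⟩
        · rintro (_ | _ | _ | t) ht h1
          · omega
          · exact Or.inl ⟨p + 1, by omega, by omega, rfl⟩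
          · exact hvm
          · exact hmono p (p + 2) _ (by omega) (hgj t (by omega)).2
        · obtain ⟨s, hs3, hs⟩ : ∃ s, s < 3 ∧ s + 2 < k + 3 ∧
              Turn E (consSeq (u p) (consSeq (u (p + 1)) (consSeq v g)) s)
                (consSeq (u p) (consSeq (u (p + 1)) (consSeq v g)) (s + 1))
                (consSeq (u p) (consSeq (u (p + 1)) (consSeq v g)) (s + 2)) := by
            rcases hturn with h | h
            · exact ⟨0, by omega, by omega, h⟩
            · refine ⟨1, by omega, by omega, ?_⟩
              rw [← hg0] at h
              exact h
          refine ⟨insert s (S.image (· + 3)), ?_, ?_⟩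
          · rw [Finset.card_insert_of_notMem, Finset.card_image_of_injective _ (add_left_injective 3)]
            · have hsub : C.filter (p < ·) ⊆ insert (p + 1) (C.filter (j < ·)) := by
                intro c hc
                rw [Finset.mem_filter] at hc
                rw [Finset.mem_insert, Finset.mem_filter]
                by_cases h : c = p + 1
                · exact Or.inl h
                · have := hsp _ hpC c hc.1 (by omega)
                  exact Or.inr ⟨hc.1, by omega⟩
              have h1 := Finset.card_le_card hsub
              have h2 := Finset.card_insert_le (p + 1) (C.filter (j < ·))
              omega
            · intro h
              obtain ⟨t, -, ht⟩ := Finset.mem_image.1 h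
              omega
          · intro t ht
            rcases Finset.mem_insert.1 ht with rfl | ht
            · exact hs
            · obtain ⟨t, htS, rfl⟩ := Finset.mem_image.1 ht
              have := hS t htS
              exact ⟨by omega, this.2⟩
      · obtain ⟨g, k, hg, hk2, hg0, hg1, hgm, S, hSc, hS⟩ := ih (m - (p + 1)) (by omega) (p + 1) hlt rfl
        have hgp : InducedPath (SimpleGraph.fromRel E) (consSeq (u p) g) (k + 1) :=
          hg.cons (by rw [hg0]; exact hadj p (by omega)) fun t ht h1 =>
            hu p (p + 1) _ (by omega) (by omega) (hgm t ht h1)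
        refine ⟨_, _, hgp, by omega, rfl, hg0, ?_, ?_⟩
        · rintro (_ | t) ht h1
          · omega
          · simp only [consSeq]
            rcases Nat.eq_zero_or_pos t with rfl | h1
            · rw [hg0]; exact Or.inl ⟨p + 1, by omega, by omega, rfl⟩
            · exact hmono _ _ _ (by omega) (hgm t (by omega) h1)
        · have hfil : C.filter (p < ·) ⊆ insert (p + 1) (C.filter (p + 1 < ·)) := by
            intro c hc
            rw [Finset.mem_filter] at hc
            rw [Finset.mem_insert, Finset.mem_filter]
            by_cases h : c = p + 1
            · exact Or.inl h
            · exact Or.inr ⟨hc.1, by omega⟩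
          by_cases hpC : p + 1 ∈ C
          · have ht0 : Turn E (u p) (u (p + 1)) (u (p + 1 + 1)) := by
              by_contra h
              exact hcase ⟨hpC, h⟩
            have hk3 : 0 + 2 < k + 1 := by omega
            refine ⟨insert 0 (S.image (· + 1)), ?_, ?_⟩
            · rw [Finset.card_insert_of_notMem (by simp),
                Finset.card_image_of_injective _ (add_left_injective 1)]
              have h1 := Finset.card_le_card hfil
              have h2 := Finset.card_insert_le (p + 1) (C.filter (p + 1 < ·))
              omega
            · intro t ht
              rcases Finset.mem_insert.1 ht with rfl | ht
              · refine ⟨hk3, ?_⟩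
                simp only [consSeq]
                rw [hg0, hg1]
                exact ht0
              · obtain ⟨t, htS, rfl⟩ := Finset.mem_image.1 ht
                have := hS t htS
                exact ⟨by omega, this.2⟩
          · refine ⟨S.image (· + 1), ?_, ?_⟩
            · rw [Finset.card_image_of_injective _ (add_left_injective 1)]
              refine le_trans (Finset.card_le_card fun c hc => ?_) hSc
              rw [Finset.mem_filter] at hc ⊢
              refine ⟨hc.1, ?_⟩
              have : c ≠ p + 1 := by rintro rfl; exact hpC hc.1
              omega
            · intro t ht
              obtain ⟨t, htS, rfl⟩ := Finset.mem_image.1 ht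
              have := hS t htS
              exact ⟨by omega, this.2⟩
  obtain ⟨g, k, hg, -, -, -, -, S, hSc, hS⟩ := key 0 (by omega)
  refine le_trans ?_ (card_turns_le h3 hE hg S hS)
  rwa [Finset.filter_true_of_mem fun c hc => by have := (hC c hc).1; omega] at hSc

theorem exists_maximal_spaced (B : Finset ℕ) (d : ℕ) (hd : 0 < d) :
    ∃ C ⊆ B, (∀ c ∈ C, ∀ c' ∈ C, c < c' → c + d ≤ c') ∧
      ∀ b ∈ B, ∃ c ∈ C, b < c + d ∧ c < b + d := by
  obtain ⟨C, hC, hmax⟩ := Finset.exists_max_image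
    (B.powerset.filter fun C => ∀ c ∈ C, ∀ c' ∈ C, c < c' → c + d ≤ c') Finset.card ⟨∅, by simp⟩
  rw [Finset.mem_filter, Finset.mem_powerset] at hC
  refine ⟨C, hC.1, hC.2, fun b hb => ?_⟩
  by_contra hcon
  push Not at hcon
  have hbC : b ∉ C := fun h => by have := hcon b h (by omega); omega
  have := hmax (insert b C) ?_
  · rw [Finset.card_insert_of_notMem hbC] at this; omega
  · rw [Finset.mem_filter, Finset.mem_powerset]
    refine ⟨Finset.insert_subset hb hC.1, ?_⟩
    intro c hc c' hc' hlt
    rcases Finset.mem_insert.1 hc with rfl | hc <;> rcases Finset.mem_insert.1 hc' with rfl | hc'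
    · omega
    · by_contra h
      have := hcon c' hc' (by omega); omega
    · by_contra h
      have := hcon c (by assumption) (by omega); omega
    · exact hC.2 c hc c' hc' hlt

end Turns

section NearPath

variable {V : Type} {E : V → V → Prop} {u : ℕ → V} {n m : ℕ}

theorem IndepBound.mono {X Y : Set V} {k : ℕ} (h : IndepBound E X k) (hYX : Y ⊆ X) :
    IndepBound E Y k := fun S hS hind => h S (fun a ha => hYX (hS a ha)) hind

theorem IndepBound.flip {X : Set V} {k : ℕ} (h : IndepBound E X k) :
    IndepBound (fun a b => E b a) X k := fun S hS hind => h S hS fun a ha b hb => hind b hb a ha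

theorem indepBound_neighbors (hn : 0 < n) (hE : ∀ u v : V, E u v → ¬ E v u)
    (hstar : ¬ HasInducedCopyG (StarG n) (SimpleGraph.fromRel E)) (c : V) :
    IndepBound E {v | (SimpleGraph.fromRel E).Adj v c} (n - 1) := by
  intro S hS hind
  have := card_lt_of_star_free hstar c S (fun a ha => (hS a ha).symm) fun a ha b hb h => by
    rcases (adj_fromRel_iff hE a b).1 h with h | h
    · exact hind a ha b hb h
    · exact hind b hb a ha h
  omega

theorem run_with_detours_pathCoverable [Finite V] {lo hi k : ℕ} (hirr : ∀ v, ¬ E v v)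
    (hup : ∀ p, lo ≤ p → p < hi → E (u p) (u (p + 1)))
    (hinj : ∀ p q, lo ≤ p → p < q → q ≤ hi → u p ≠ u q) (A : V → ℕ → ℕ → Prop)
    (hA : ∀ v i j i' j', A v i j → A v i' j' → i = i')
    (hoff : ∀ v i j, A v i j → ∀ q, lo ≤ q → q ≤ hi → v ≠ u q)
    (hB : ∀ p, IndepBound E {v | ∃ j, A v p j} k)
    (hor : ∀ v i j, lo ≤ i → i < j → j ≤ hi → A v i j → E (u i) v ∧ E v (u j)) :
    PathCoverable E ({x | ∃ p, lo ≤ p ∧ p ≤ hi ∧ x = u p} ∪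
      {v | ∃ i j, lo ≤ i ∧ i < j ∧ j ≤ i + 3 ∧ j ≤ hi ∧ A v i j}) (1 + 6 * k) := by
  let B : ℕ → ℕ → Set V := fun d p => {v | lo ≤ p ∧ p + d ≤ hi ∧ A v p (p + d)}
  have hd : ∀ d ∈ Finset.Icc 1 3,
      PathCoverable E {v | ∃ p, lo ≤ p ∧ p + d ≤ hi ∧ v ∈ B d p} (d * k) := by
    intro d hd
    rw [Finset.mem_Icc] at hd
    refine detours_pathCoverable hup hinj hirr (by omega) (B d) k ?_ ?_ ?_ ?_ ?_
    · exact fun p => (hB p).mono fun v hv => ⟨_, hv.2.2⟩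
    · exact fun p v hv => hoff v _ _ hv.2.2
    · exact fun p q hpq v hv hv' => hpq (hA v _ _ _ _ hv.2.2 hv'.2.2)
    · exact fun p v hv => (hor v _ _ hv.1 (by omega) hv.2.1 hv.2.2).1
    · exact fun p v hv => (hor v _ _ hv.1 (by omega) hv.2.1 hv.2.2).2
  have hsum : ∑ d ∈ Finset.Icc 1 3, d * k = 6 * k := by
    rw [← Finset.sum_mul]; rfl
  refine ((run_pathCoverable hup hinj).union (PathCoverable.biUnion _ hd)).mono ?_ (by rw [hsum])
  refine Set.union_subset_union_right _ ?_
  rintro v ⟨i, j, h1, h2, h3, h4, h5⟩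
  simp only [Set.mem_iUnion]
  refine ⟨j - i, Finset.mem_Icc.2 ⟨by omega, by omega⟩, i, h1, by omega, h1, by omega, ?_⟩
  rwa [Nat.add_sub_cancel' h2.le]

/-- The arcs between `v` and `u i`, `u j` are oriented as the arc between `u i` and `u (i + 1)`. -/
def OrientedDetour (E : V → V → Prop) (u : ℕ → V) (v : V) (i j : ℕ) : Prop :=
  (E (u i) (u (i + 1)) → E (u i) v ∧ E v (u j)) ∧ (E (u (i + 1)) (u i) → E v (u i) ∧ E (u j) v)

theorem orientedDetour_of_forall_not_badPos (hn : 0 < n)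
    (hF1 : ¬ HasInducedCopyG (F1G n) (SimpleGraph.fromRel E))
    (hF2 : ¬ HasInducedCopyG (F2G n) (SimpleGraph.fromRel E)) (h2 : CondD2 n E)
    (hE : ∀ u v : V, E u v → ¬ E v u) (hP : InducedPath (SimpleGraph.fromRel E) u m) {v : V} {i j : ℕ}
    (hA : Attached (SimpleGraph.fromRel E) u m v i j) (hi : 2 * n + 1 ≤ i) (hj : j + (2 * n + 1) < m)
    (hgood : ∀ p, i ≤ p + n → p ≤ j + n → ¬ BadPos E u n m p) :
    i < j ∧ j ≤ i + 3 ∧ OrientedDetour E u v i j := by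
  obtain ⟨hij, hj3⟩ := neighbors_span hF1 hF2 hP hA.ne (by omega) (by omega) hA.adj_min hA.adj_max
    hA.min hA.max
  refine ⟨hij, hj3, ?_⟩
  have hrun := run_oriented (E := E) (u := u) (lo := i - n) (hi := j + n)
    (fun p _ hp' => (adj_fromRel_iff hE _ _).1 ((hP.adj p (by omega) (p + 1) (by omega)).2 (Or.inl rfl)))
    (fun p hp hp' ht => hgood (p + 1) (by omega) (by omega) ⟨by omega, by omega, Or.inl ht⟩)
  have hvi := (adj_fromRel_iff hE _ _).1 hA.adj_min
  have hvj := (adj_fromRel_iff hE _ _).1 hA.adj_max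
  have hlocal : ((∀ p, i - n ≤ p → p < j + n → E (u p) (u (p + 1))) → E (u i) v ∧ E v (u j)) ∧
      ((∀ p, i - n ≤ p → p < j + n → E (u (p + 1)) (u p)) → E v (u i) ∧ E (u j) v) := by
    by_cases hj1 : j = i + 1
    · subst hj1
      constructor
      · intro hup
        exact triangle_oriented h2 hE hP hA.ne (by omega) (by omega) hA.adj_min hA.adj_max hA.min
          hA.max fun p hp hp' => hup p (by omega) (by omega)
      · intro hdown
        exact (triangle_oriented_down hn h2 hE hP hA.ne (by omega) (by omega) hA.adj_min hA.adj_max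
          hA.min hA.max fun p hp hp' => hdown p (by omega) (by omega)).symm
    · have hnb := hgood i (by omega) (by omega)
      have hturn : ¬ (Turn E (u (i - 1)) (u i) v ∨ Turn E (u i) v (u j)) := fun h =>
        hnb ⟨by omega, by omega, Or.inr ⟨v, j, hA, by omega, by omega, h⟩⟩
      simp only [Turn] at hturn
      constructor
      · intro hup
        have := hup (i - 1) (by omega) (by omega)
        rw [show i - 1 + 1 = i by omega] at this
        tauto
      · intro hdown
        have := hdown (i - 1) (by omega) (by omega)
        rw [show i - 1 + 1 = i by omega] at this
        tauto
  rcases hrun with hup | hdown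
  · have := hup i (by omega) (by omega)
    exact ⟨fun _ => hlocal.1 hup, fun h => absurd h (hE _ _ this)⟩
  · have := hdown i (by omega) (by omega)
    exact ⟨fun h => absurd h (hE _ _ this), fun _ => hlocal.2 hdown⟩

/-- The path and its oriented detours at positions away from its turns. -/
theorem detours_of_path_pathCoverable [Finite V] (hn : 0 < n) (h3 : CondD3 n E)
    (hstar : ¬ HasInducedCopyG (StarG n) (SimpleGraph.fromRel E))
    (hE : ∀ u v : V, E u v → ¬ E v u) (hP : InducedPath (SimpleGraph.fromRel E) u m) :
    PathCoverable E ({x | ∃ p < m, x = u p} ∪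
      {v | ∃ i j, i < j ∧ j ≤ i + 3 ∧ Attached (SimpleGraph.fromRel E) u m v i j ∧
        OrientedDetour E u v i j ∧
        ∀ p, i ≤ p → p + 1 < j → ¬ Turn E (u p) (u (p + 1)) (u (p + 2))})
      ((n + 1) * (1 + 6 * (n - 1))) := by
  classical
  let T := (Finset.range m).filter fun t => t + 2 < m ∧ Turn E (u t) (u (t + 1)) (u (t + 2))
  have hT : T.card ≤ n := card_turns_le h3 hE hP T fun t ht => (Finset.mem_filter.1 ht).2
  let starts := insert 0 (T.image (· + 1))
  have hstarts : starts.card ≤ n + 1 := (Finset.card_insert_le _ _).trans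
    (Nat.add_le_add_right (Finset.card_image_le.trans hT) 1)
  let hi : ℕ → ℕ := fun c => Nat.findGreatest (fun h => ∀ t ∈ T, c < t + 1 → h ≤ t + 1) (m - 1)
  have hhi : ∀ c, ∀ t ∈ T, c < t + 1 → hi c ≤ t + 1 := fun c =>
    Nat.findGreatest_spec (P := fun h => ∀ t ∈ T, c < t + 1 → h ≤ t + 1) (Nat.zero_le (m - 1))
      (fun _ _ _ => Nat.zero_le _)
  have hhim : ∀ c, hi c ≤ m - 1 := fun c => Nat.findGreatest_le _
  have hlehi : ∀ c h, h ≤ m - 1 → (∀ t ∈ T, c < t + 1 → h ≤ t + 1) → h ≤ hi c := fun c h h1 h2 =>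
    Nat.le_findGreatest h1 h2
  have hinj : ∀ c p q, c ≤ p → p < q → q ≤ hi c → u p ≠ u q := by
    intro c p q _ h1 h2 h
    have := hhim c
    have := hP.inj p (by omega) q (by omega) h
    omega
  let A : V → ℕ → ℕ → Prop := fun v i j =>
    Attached (SimpleGraph.fromRel E) u m v i j ∧ OrientedDetour E u v i j
  have hoff : ∀ c, 0 < m → ∀ v i j, A v i j → ∀ q, c ≤ q → q ≤ hi c → v ≠ u q :=
    fun c hm v i j h q _ hq => h.1.ne q (by have := hhim c; omega)
  have hA : ∀ v i j i' j', A v i j → A v i' j' → i = i' := fun v i j i' j' h h' => h.1.unique h'.1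
  have hB : ∀ p, IndepBound E {v | ∃ j, A v p j} (n - 1) := fun p =>
    (indepBound_neighbors hn hE hstar (u p)).mono fun v ⟨j, hj⟩ => hj.1.adj_min
  rcases Nat.eq_zero_or_pos m with hm | hm
  · refine ⟨[], by simp, by simp, ?_⟩
    rintro v (⟨p, hp, -⟩ | ⟨i, j, -, -, h, -⟩)
    · omega
    · have := h.lt; omega
  have key : ∀ c ∈ starts, PathCoverable E ({x | ∃ p, c ≤ p ∧ p ≤ hi c ∧ x = u p} ∪
      {v | ∃ i j, c ≤ i ∧ i < j ∧ j ≤ i + 3 ∧ j ≤ hi c ∧ A v i j}) (1 + 6 * (n - 1)) := by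
    intro c _
    have hcm := hhim c
    rcases run_oriented (E := E) (u := u) (lo := c) (hi := hi c)
      (fun p _ hp' => (adj_fromRel_iff hE _ _).1
        ((hP.adj p (by omega) (p + 1) (by omega)).2 (Or.inl rfl)))
      (fun p hp hp' ht => by
        have := hhi c p (Finset.mem_filter.2 ⟨Finset.mem_range.2 (by omega), by omega, ht⟩) (by omega)
        omega) with hup | hdown
    · exact run_with_detours_pathCoverable (fun v h => hE _ _ h h) hup (hinj c) A hA (hoff c hm) hB
        fun v i j h1 h2 h3 h => h.2.1 (hup i h1 (by omega))
    · exact (run_with_detours_pathCoverable (E := fun a b => E b a) (fun v h => hE _ _ h h) hdown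
        (hinj c) A hA (hoff c hm) (fun p => (hB p).flip)
        fun v i j h1 h2 h3 h => h.2.2 (hdown i h1 (by omega))).of_flip
  have hstart : ∀ p, ∃ c ∈ starts, c ≤ p ∧ ∀ t ∈ T, c < t + 1 → p < t + 1 := by
    intro p
    have hne : (starts.filter (· ≤ p)).Nonempty := ⟨0, by simp [starts]⟩
    have hmem := Finset.max'_mem _ hne
    rw [Finset.mem_filter] at hmem
    refine ⟨_, hmem.1, hmem.2, fun t ht hlt => ?_⟩
    by_contra hle
    have := Finset.le_max' (starts.filter (· ≤ p)) (t + 1) (Finset.mem_filter.2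
      ⟨Finset.mem_insert_of_mem (Finset.mem_image_of_mem _ ht), by omega⟩)
    omega
  refine (PathCoverable.biUnion starts key).mono ?_ ?_
  · rintro v (⟨p, hp, rfl⟩ | ⟨i, j, h1, h2, h3, h4, h5⟩)
    · obtain ⟨c, hc, hcp, hct⟩ := hstart p
      simp only [Set.mem_iUnion]
      exact ⟨c, hc, Or.inl ⟨p, hcp, hlehi c p (by omega) fun t ht h => (hct t ht h).le, rfl⟩⟩
    · obtain ⟨c, hc, hci, hct⟩ := hstart i
      simp only [Set.mem_iUnion]
      refine ⟨c, hc, Or.inr ⟨i, j, hci, h1, h2, hlehi c j (by have := h3.lt; omega) ?_, h3, h4⟩⟩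
      intro t ht h
      have hit := hct t ht h
      by_contra hlt
      exact h5 t (by omega) (by omega) (Finset.mem_filter.1 ht).2.2
  · rw [Finset.sum_const, smul_eq_mul]
    exact Nat.mul_le_mul_right _ hstarts

theorem nearPath_pathCoverable [Finite V] (hn : 2 ≤ n) (h1 : CondD1 n E) (h2 : CondD2 n E)
    (h3 : CondD3 n E) (hE : ∀ u v : V, E u v → ¬ E v u)
    (hP : InducedPath (SimpleGraph.fromRel E) u m) :
    PathCoverable E {v | ∃ p < m, v = u p ∨ (SimpleGraph.fromRel E).Adj v (u p)}
      ((2 * (2 * n + 1) + n * (4 * n + 11)) * (n - 1) + (n + 1) * (1 + 6 * (n - 1))) := by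
  classical
  obtain ⟨-, hstar, hF1, hF2⟩ := h1
  obtain ⟨C, hCB, hsp, hCmax⟩ := exists_maximal_spaced
    ((Finset.range m).filter (BadPos E u n m)) (n + 3) (by omega)
  have hCcard := card_spaced_badPos_le hn hF1 hF2 h3 hE hP C
    (fun c hc => (Finset.mem_filter.1 (hCB hc)).2) hsp
  let W := (Finset.range (2 * n + 1) ∪ Finset.Ico (m - (2 * n + 1)) m) ∪
    C.biUnion fun c => Finset.Icc (c - (2 * n + 5)) (c + (2 * n + 5))
  have hW : W.card ≤ 2 * (2 * n + 1) + n * (4 * n + 11) := by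
    refine (Finset.card_union_le _ _).trans (Nat.add_le_add ?_ ?_)
    · refine (Finset.card_union_le _ _).trans ?_
      rw [Finset.card_range, Nat.card_Ico]; omega
    · refine (Finset.card_biUnion_le_card_mul _ _ (4 * n + 11) fun c _ => ?_).trans
        (Nat.mul_le_mul_right _ hCcard)
      rw [Nat.card_Icc]; omega
  have hhub : PathCoverable E (⋃ p ∈ W, {v | (SimpleGraph.fromRel E).Adj v (u p)})
      (∑ p ∈ W, (n - 1)) := PathCoverable.biUnion W fun p _ =>
    (indepBound_neighbors (by omega) hE hstar (u p)).pathCoverable fun v h => hE _ _ h h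
  refine (hhub.union (detours_of_path_pathCoverable (by omega) h3 hstar hE hP)).mono ?_ ?_
  · rintro v ⟨p, hp, hvp⟩
    by_cases hvP : ∃ p < m, v = u p
    · exact Or.inr (Or.inl hvP)
    by_cases hvW : ∃ p ∈ W, (SimpleGraph.fromRel E).Adj v (u p)
    · left
      obtain ⟨q, hq, hvq⟩ := hvW
      exact Set.mem_biUnion hq hvq
    push Not at hvP hvW
    obtain ⟨i, j, hij, hjm, hvi, hvj, hmin, hmax⟩ := exists_extreme_neighbors
      (⟨p, hp, hvp.resolve_left (hvP p hp)⟩ : ∃ p < m, (SimpleGraph.fromRel E).Adj v (u p))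
    have hA : Attached (SimpleGraph.fromRel E) u m v i j := ⟨hvP, hjm, hvi, hvj, hmin, hmax⟩
    have hiW : i ∉ W := fun h => hvW i h hvi
    have hjW : j ∉ W := fun h => hvW j h hvj
    simp only [W, Finset.mem_union, Finset.mem_range, Finset.mem_Ico, Finset.mem_biUnion,
      Finset.mem_Icc, not_or, not_exists, not_and] at hiW hjW
    have hi' : 2 * n + 1 ≤ i := by have := hiW.1.1; omega
    have hj' : j + (2 * n + 1) < m := by
      have := hjW.1.2
      by_contra h
      exact this (by omega) hjm
    have hspan := neighbors_span hF1 hF2 hP hvP (by omega) (by omega) hvi hvj hmin hmax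
    have hgood : ∀ p, i ≤ p + n → p ≤ j + n → ¬ BadPos E u n m p := by
      intro q hq1 hq2 hbad
      obtain ⟨c, hc, hc1, hc2⟩ := hCmax q (Finset.mem_filter.2 ⟨Finset.mem_range.2 (by omega), hbad⟩)
      exact hiW.2 c hc (by omega) (by omega)
    obtain ⟨g1, g2, g3⟩ := orientedDetour_of_forall_not_badPos (by omega) hF1 hF2 h2 hE hP hA hi' hj'
      hgood
    refine Or.inr (Or.inr ⟨i, j, g1, g2, hA, g3, fun q hq1 hq2 ht => ?_⟩)
    exact hgood (q + 1) (by omega) (by omega) ⟨by omega, by omega, Or.inl ht⟩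
  · rw [Finset.sum_const, smul_eq_mul]
    exact Nat.add_le_add_right (Nat.mul_le_mul_right _ hW) _

end NearPath

section Assembly

variable {V : Type} {G : SimpleGraph V} {E : V → V → Prop} {u : ℕ → V} {n m : ℕ} {δ : V → ℕ}

theorem InducedPath.le_card [Fintype V] (hP : InducedPath G u m) : m ≤ Fintype.card V := by
  simpa using Fintype.card_le_of_injective (fun i : Fin m => u i) fun i j h =>
    Fin.ext (hP.inj i i.2 j j.2 h)

theorem exists_longest_inducedPath [Fintype V] [Nonempty V] (G : SimpleGraph V) :
    ∃ u m, 0 < m ∧ InducedPath G u m ∧ ∀ g k, InducedPath G g k → k ≤ m := by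
  classical
  have hone : ∃ u, InducedPath G u 1 :=
    ⟨fun _ => Classical.arbitrary V, ⟨fun s hs t ht _ => by omega, fun s hs t ht =>
      ⟨fun h => (G.irrefl h).elim, fun h => by omega⟩⟩⟩
  have hcard : 1 ≤ Fintype.card V := Fintype.card_pos
  let m := Nat.findGreatest (fun k => ∃ u, InducedPath G u k) (Fintype.card V)
  obtain ⟨u, hu⟩ : ∃ u, InducedPath G u m :=
    Nat.findGreatest_spec (P := fun k => ∃ u, InducedPath G u k) hcard hone
  exact ⟨u, m, Nat.le_findGreatest hcard hone, hu,
    fun g k hg => Nat.le_findGreatest hg.le_card ⟨g, hg⟩⟩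

theorem IndepBound.biUnion {ι : Type*} {s : Finset ι} {X : ι → Set V} {k : ℕ}
    (h : ∀ i ∈ s, IndepBound E (X i) k) : IndepBound E (⋃ i ∈ s, X i) (s.card * k) := by
  classical
  intro S hS hind
  have hsub : S ⊆ s.biUnion fun i => S.filter (· ∈ X i) := by
    intro v hv
    obtain ⟨i, hi, hvi⟩ := Set.mem_iUnion₂.1 (hS v hv)
    exact Finset.mem_biUnion.2 ⟨i, hi, Finset.mem_filter.2 ⟨hv, hvi⟩⟩
  refine (Finset.card_le_card hsub).trans (Finset.card_biUnion_le_card_mul _ _ _ fun i hi => ?_)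
  exact h i hi _ (fun a ha => (Finset.mem_filter.1 ha).2) fun a ha b hb =>
    hind a (Finset.mem_filter.1 ha).1 b (Finset.mem_filter.1 hb).1

/-- The first-layer vertices with a neighbor in the second layer have all their independent sets
of size at most `2n(n - 1)`. -/
theorem indepBound_firstLayer (hn : 0 < n) (h1 : CondD1 n E) (hE : ∀ u v : V, E u v → ¬ E v u)
    (hδ : LayerFn (SimpleGraph.fromRel E) u m δ) (hP : InducedPath (SimpleGraph.fromRel E) u m) :
    IndepBound E {v | δ v = 1 ∧ ∃ x, (SimpleGraph.fromRel E).Adj v x ∧ δ x = 2}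
      (2 * n * (n - 1)) := by
  obtain ⟨-, hstar, hF1, hF2⟩ := h1
  have hcard : (Finset.range n ∪ Finset.Ico (m - n) m).card ≤ 2 * n := by
    refine (Finset.card_union_le _ _).trans ?_
    rw [Finset.card_range, Nat.card_Ico]; omega
  have hb := IndepBound.biUnion (s := Finset.range n ∪ Finset.Ico (m - n) m)
    fun p _ => indepBound_neighbors hn hE hstar (u p)
  intro S hS hind
  refine (hb S (fun v hv => ?_) hind).trans (Nat.mul_le_mul_right _ hcard)
  obtain ⟨hv1, x, hvx, hx⟩ := hS v hv
  obtain ⟨p, hp, hpe, hvp⟩ := exists_end_neighbor hF1 hF2 hδ hP hv1 hx hvx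
  refine Set.mem_biUnion (x := p) ?_ hvp
  simp only [Finset.coe_union, Finset.coe_range, Finset.coe_Ico, Set.mem_union, Set.mem_Iio,
    Set.mem_Ico]
  omega

theorem indepBound_layer (hn : 2 ≤ n) {a : ℕ → ℕ}
    (haS : ∀ i : ℕ, a (i + 1) = (n - 1) * ramseyNumber n (a i + 1) - 1)
    (ha1 : 2 * n * (n - 1) ≤ a 1) (h1 : CondD1 n E) (hE : ∀ u v : V, E u v → ¬ E v u)
    (hδ : LayerFn (SimpleGraph.fromRel E) u m δ) (hP : InducedPath (SimpleGraph.fromRel E) u m)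
    (k : ℕ) : IndepBound E {v | δ v = k + 2} (a (k + 2)) := by
  induction k with
  | zero =>
    have hb : IndepBound E {v | δ v = 1 ∧ ∃ x, (SimpleGraph.fromRel E).Adj v x ∧ δ x = 2} (a 1) :=
      fun S hS hind => (indepBound_firstLayer (by omega) h1 hE hδ hP S hS hind).trans ha1
    rw [haS]
    refine hb.of_dominated hn hE h1.1 h1.2.1 fun y hy => ?_
    obtain ⟨w, hw, hw1⟩ := hδ.exists_pred y 1 hy
    exact ⟨w, ⟨hw1, y, hw.symm, hy⟩, hw.symm⟩
  | succ k ih =>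
    rw [haS]
    refine ih.of_dominated hn hE h1.1 h1.2.1 fun y hy => ?_
    obtain ⟨w, hw, hwk⟩ := hδ.exists_pred y (k + 2) hy
    exact ⟨w, hwk, hw.symm⟩

end Assembly

section Growth

variable {a : ℕ → ℕ} {n : ℕ}

theorem sq_mul_le_succ (hn : 2 ≤ n)
    (haS : ∀ i : ℕ, a (i + 1) = (n - 1) * ramseyNumber n (a i + 1) - 1) (i : ℕ) :
    (n - 1) ^ 2 * a i ≤ a (i + 1) := by
  obtain ⟨q, rfl⟩ : ∃ q, n = q + 1 := ⟨n - 1, by omega⟩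
  have hR := lt_ramseyNumber q (a i) (by omega)
  rw [haS, Nat.add_sub_cancel]
  have hmul := Nat.mul_le_mul_left q (Nat.succ_le_of_lt hR)
  have hq : q * (q * a i).succ = q ^ 2 * a i + q := by rw [Nat.succ_eq_add_one]; ring
  omega

theorem monotone_of_ramsey_recursion (hn : 2 ≤ n)
    (haS : ∀ i : ℕ, a (i + 1) = (n - 1) * ramseyNumber n (a i + 1) - 1) : Monotone a :=
  monotone_nat_of_le_succ fun i =>
    (Nat.le_mul_of_pos_left _ (pow_pos (by omega) 2)).trans (sq_mul_le_succ hn haS i)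

theorem pow_mul_le_of_ramsey_recursion (hn : 2 ≤ n)
    (haS : ∀ i : ℕ, a (i + 1) = (n - 1) * ramseyNumber n (a i + 1) - 1) (i : ℕ) :
    (n - 1) ^ (2 * i) * a 0 ≤ a i := by
  induction i with
  | zero => simp
  | succ i ih =>
    calc (n - 1) ^ (2 * (i + 1)) * a 0 = (n - 1) ^ 2 * ((n - 1) ^ (2 * i) * a 0) := by ring
      _ ≤ (n - 1) ^ 2 * a i := Nat.mul_le_mul_left _ ih
      _ ≤ a (i + 1) := sq_mul_le_succ hn haS i

theorem nearPath_bound_le (hn : 3 ≤ n) :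
    (2 * (2 * n + 1) + n * (4 * n + 11)) * (n - 1) + (n + 1) * (1 + 6 * (n - 1)) ≤
      (n - 1) ^ 8 * n := by
  obtain ⟨q, rfl⟩ : ∃ q, n = q + 1 := ⟨n - 1, by omega⟩
  have hq : 2 ≤ q := by omega
  rw [Nat.add_sub_cancel]
  have h6 : 64 ≤ q ^ 6 := Nat.pow_le_pow_left hq 6
  have h2 : 2 * q ≤ q ^ 2 := by nlinarith
  calc (2 * (2 * (q + 1) + 1) + (q + 1) * (4 * (q + 1) + 11)) * q + (q + 1 + 1) * (1 + 6 * q)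
      = 4 * (q ^ 2 * q) + 29 * q ^ 2 + 34 * q + 2 := by ring
    _ ≤ 64 * (q ^ 2 * q) + 64 * q ^ 2 := by nlinarith [Nat.zero_le (q ^ 2 * q)]
    _ = 64 * (q ^ 2 * (q + 1)) := by ring
    _ ≤ q ^ 6 * (q ^ 2 * (q + 1)) := Nat.mul_le_mul_right _ h6
    _ = q ^ 8 * (q + 1) := by ring

end Growth

/-- Explicit bound on `pc(D)` for weakly connected digraphs
satisfying (D1), (D2) and (D3), where `n₀ = max{⌈(n²−n−2)/2⌉, n}`, `α₀ = 2⌈n₀/2⌉`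
and `α_i = (n−1)·R(n, α_{i−1}+1) − 1`. -/
theorem pc_le_explicit_bound (n : ℕ) (hn : 3 ≤ n)
    (n₀ : ℕ) (hn₀ : n₀ = max ((n ^ 2 - n - 1) / 2) n)
    (a : ℕ → ℕ) (ha0 : a 0 = 2 * ((n₀ + 1) / 2))
    (haS : ∀ i : ℕ, a (i + 1) = (n - 1) * ramseyNumber n (a i + 1) - 1)
    (V : Type) [Fintype V] (E : V → V → Prop)
    (hE : ∀ u v : V, E u v → ¬ E v u)
    (hconn : (SimpleGraph.fromRel E).Connected)
    (h1 : CondD1 n E) (h2 : CondD2 n E) (h3 : CondD3 n E) :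
    pcOn E Set.univ ≤ (∑ i ∈ Finset.Icc 1 (2 * n₀ - 1), a i) +
      n * (2 * n - 1) * (n - 1) +
      (n + 1) * ((n - 2) * n * (n + 5) / 2 + 6 * (n - 2)) := by
  have := hconn.nonempty
  obtain ⟨u, m, hm, hP, hlong⟩ := exists_longest_inducedPath (SimpleGraph.fromRel E)
  obtain ⟨δ, hδ⟩ := exists_layerFn (u := u) hconn hm
  have hn₀n : n ≤ n₀ := hn₀ ▸ le_max_right _ _
  have hn₀sq : n * n ≤ 2 * n₀ + n + 2 := by
    have hle : (n ^ 2 - n - 1) / 2 ≤ n₀ := hn₀ ▸ le_max_left _ _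
    rw [← sq]; omega
  have hna : n ≤ a 0 := by omega
  have ha1 : 2 * n * (n - 1) ≤ a 1 := by
    refine le_trans ?_ (sq_mul_le_succ (by omega) haS 0)
    calc 2 * n * (n - 1) = 2 * (n - 1) * n := by ring
      _ ≤ (n - 1) ^ 2 * a 0 := Nat.mul_le_mul (by rw [sq]; gcongr; omega) hna
  have hdepth : ∀ v, δ v < 2 * n₀ - 1 := by
    intro v
    by_contra hv
    push Not at hv
    obtain ⟨w, -, hw, -⟩ := hδ.exists_descent (v := v) rfl
    exact layer_ne hn h1.2.2.1 h1.2.2.2 h1.2.1 hδ hP hlong (by omega) (by omega) _ (hw _ hv)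
  have hnear := nearPath_pathCoverable (by omega) h1 h2 h3 hE hP
  have hfar : PathCoverable E (⋃ k ∈ Finset.Icc 2 (2 * n₀ - 2), {v | δ v = k})
      (∑ k ∈ Finset.Icc 2 (2 * n₀ - 2), a k) := PathCoverable.biUnion _ fun k hk => by
    obtain ⟨j, rfl⟩ : ∃ j, k = j + 2 := ⟨k - 2, by have := Finset.mem_Icc.1 hk; omega⟩
    exact (indepBound_layer (by omega) haS ha1 h1 hE hδ hP j).pathCoverable fun v h => hE _ _ h h
  have hlast : (2 * (2 * n + 1) + n * (4 * n + 11)) * (n - 1) + (n + 1) * (1 + 6 * (n - 1)) ≤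
      a (2 * n₀ - 1) :=
    calc _ ≤ (n - 1) ^ (2 * 4) * n := nearPath_bound_le hn
      _ ≤ (n - 1) ^ (2 * 4) * a 0 := Nat.mul_le_mul_left _ hna
      _ ≤ a 4 := pow_mul_le_of_ramsey_recursion (by omega) haS 4
      _ ≤ a (2 * n₀ - 1) := monotone_of_ramsey_recursion (by omega) haS (by omega)
  have hsum : a (2 * n₀ - 1) + ∑ k ∈ Finset.Icc 2 (2 * n₀ - 2), a k ≤
      ∑ i ∈ Finset.Icc 1 (2 * n₀ - 1), a i := by
    have hnot : 2 * n₀ - 1 ∉ Finset.Icc 2 (2 * n₀ - 2) := by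
      rw [Finset.mem_Icc]; omega
    rw [← Finset.sum_insert hnot]
    refine Finset.sum_le_sum_of_subset fun i hi => ?_
    rw [Finset.mem_insert, Finset.mem_Icc] at hi
    rw [Finset.mem_Icc]; omega
  refine ((hnear.union hfar).mono (fun v _ => ?_) ?_).pcOn_univ_le
  · rcases Nat.lt_or_ge (δ v) 2 with hv | hv
    · left
      rcases (show δ v = 0 ∨ δ v = 1 by omega) with hv | hv
      · obtain ⟨p, hp, hvp⟩ := (hδ.zero_iff v).1 hv
        exact ⟨p, hp, Or.inl hvp⟩
      · obtain ⟨p, hp, hvp⟩ := hδ.exists_adj_path hv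
        exact ⟨p, hp, Or.inr hvp⟩
    · right
      have := hdepth v
      exact Set.mem_biUnion (x := δ v) (Finset.mem_coe.2 (Finset.mem_Icc.2 (by omega))) rfl
  · exact (((Nat.add_le_add_right hlast _).trans hsum).trans (Nat.le_add_right _ _)).trans
      (Nat.le_add_right _ _)
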